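/- arXiv:1704.03698 — 3 statements merged into one kernel-verified Lean document; each statement's English description precedes it below -/
import Mathlib

section
/- Let u : ℝ³ → ℝ be a control function that is continuous in all variables and locally Lipschitz in (q,p). Let μ = (q*, 0) with 0 < q* < π be an equilibrium of the system q̇ = p, ṗ = u(q,p,t)·sin q − cos q (i.e. u(q*,0,t)·sin q* − cos q* = 0 for all t), and let t₀ ∈ ℝ. Suppose there exists a Lyapunov function V satisfying conditions L1 and L2 on a closed set U ⊆ M containing μ in its interior. Then there exist an initial condition (q₀, p₀) with 0 < q₀ < π and an open neighborhood B ⊆ M of μ such that every solution (q(t), p(t)) of the system with (q(t₀), p(t₀)) = (q₀, p₀) satisfies 0 < q(t) < π and (q(t), p(t)) ∉ B for all t ≥ t₀ in its interval of existence. -/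
open Real Set

/-- Solutions of the differential equation with field `f` on `[a,b]`. -/
def IsSol {E : Type*} [NormedAddCommGroup E] [NormedSpace ℝ E]
    (f : ℝ → E → E) (a b : ℝ) (x : ℝ → E) : Prop :=
  ∀ t ∈ Icc a b, HasDerivWithinAt x (f t (x t)) (Icc a b) t

/-- The field can be truncated to a bounded globally Lipschitz one. -/
def HasTrunc {E : Type*} [NormedAddCommGroup E] [NormedSpace ℝ E]
    (f : ℝ → E → E) : Prop :=
  ∀ a b R : ℝ, ∃ (g : ℝ → E → E) (K C : NNReal), (∀ z, Continuous fun t => g t z) ∧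
    (∀ t, LipschitzWith K (g t)) ∧ (∀ t z, ‖g t z‖ ≤ C) ∧
    ∀ t ∈ Icc a b, ∀ z, ‖z‖ ≤ R → g t z = f t z

section abs
variable {E : Type*} [NormedAddCommGroup E] [NormedSpace ℝ E]

lemma IsSol.mono {f : ℝ → E → E} {a b a' b' : ℝ} {x : ℝ → E} (h : IsSol f a b x)
    (ha : a ≤ a') (hb : b' ≤ b) : IsSol f a' b' x := fun t ht =>
  (h t ⟨ha.trans ht.1, ht.2.trans hb⟩).mono (Icc_subset_Icc ha hb)

lemma IsSol.cont {f : ℝ → E → E} {a b : ℝ} {x : ℝ → E} (h : IsSol f a b x) :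
    ContinuousOn x (Icc a b) := fun t ht => (h t ht).continuousWithinAt

lemma IsSol.right {f : ℝ → E → E} {a b : ℝ} {x : ℝ → E} (h : IsSol f a b x) :
    ∀ t ∈ Ico a b, HasDerivWithinAt x (f t (x t)) (Ici t) t := fun t ht =>
  (h t ⟨ht.1, ht.2.le⟩).mono_of_mem_nhdsWithin
    (Filter.mem_of_superset (Icc_mem_nhdsGE ht.2) (Icc_subset_Icc ht.1 le_rfl))

lemma IsSol.congr_field {f g : ℝ → E → E} {a b : ℝ} {x : ℝ → E} (h : IsSol f a b x)
    (hfg : ∀ t ∈ Icc a b, f t (x t) = g t (x t)) : IsSol g a b x := fun t ht => by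
  rw [← hfg t ht]; exact h t ht

lemma global_exist [CompleteSpace E] {g : ℝ → E → E} {K C : NNReal}
    (hc : ∀ z, Continuous fun t => g t z)
    (hl : ∀ t, LipschitzWith K (g t)) (hb : ∀ t z, ‖g t z‖ ≤ C) {a b : ℝ} (hab : a ≤ b) (x0 : E) :
    ∃ x, x a = x0 ∧ IsSol g a b x := by
  have hP : IsPicardLindelof g (⟨a, le_rfl, hab⟩ : Icc a b) x0
      (C * ⟨b - a, sub_nonneg.2 hab⟩) 0 C K :=
    { lipschitzOnWith := fun t _ => (hl t).lipschitzOnWith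
      continuousOn := fun z _ => (hc z).continuousOn
      norm_le := fun t _ z _ => hb t z
      mul_max_le := by simp [hab]; exact le_rfl }
  exact hP.exists_eq_forall_mem_Icc_hasDerivWithinAt₀

lemma IsSol.bound {f : ℝ → E → E} {a b : ℝ} {x : ℝ → E} (h : IsSol f a b x) :
    ∃ R, ∀ t ∈ Icc a b, ‖x t‖ ≤ R := isCompact_Icc.exists_bound_of_continuousOn h.cont

lemma IsSol.near [CompleteSpace E] {f : ℝ → E → E} (hf : HasTrunc f) {a b : ℝ} (hab : a ≤ b)
    {x : ℝ → E} (h : IsSol f a b x) {ε : ℝ} (hε : 0 < ε) :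
    ∃ δ > 0, ∀ z, dist z (x a) < δ → ∃ y, y a = z ∧ IsSol f a b y ∧
      ∀ t ∈ Icc a b, dist (y t) (x t) < ε := by
  obtain ⟨R, hR⟩ := h.bound
  obtain ⟨g, K, C, hc, hl, hb, hg⟩ := hf a b (R + 1)
  have hx : IsSol g a b x := h.congr_field fun t ht =>
    (hg t ht _ ((hR t ht).trans (by linarith))).symm
  have hm : 0 < min ε 1 := lt_min hε one_pos
  refine ⟨min ε 1 * exp (-(K * (b - a))), by positivity, fun z hz => ?_⟩
  obtain ⟨y, hy0, hy⟩ := global_exist hc hl hb hab z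
  have key : ∀ t ∈ Icc a b, dist (y t) (x t) < min ε 1 := by
    intro t ht
    have := dist_le_of_trajectories_ODE hl hy.cont hy.right hx.cont hx.right le_rfl t ht
    rw [hy0] at this
    calc _ ≤ _ := this
      _ ≤ dist z (x a) * exp (K * (b - a)) := by gcongr; exact ht.2
      _ < min ε 1 * exp (-(K * (b - a))) * exp (K * (b - a)) := by gcongr
      _ = _ := by rw [mul_assoc, ← exp_add]; simp
  refine ⟨y, hy0, hy.congr_field fun t ht => hg t ht _ ?_, fun t ht => 
    (key t ht).trans_le (min_le_left _ _)⟩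
  have h1 := (key t ht).trans_le (min_le_right _ _)
  rw [dist_eq_norm] at h1
  have := norm_le_norm_add_norm_sub (x t) (y t)
  rw [norm_sub_rev] at this
  linarith [hR t ht]

lemma IsSol.unique_aux {g : ℝ → E → E} {K : NNReal}
    (hl : ∀ t, LipschitzWith K (g t)) {a b : ℝ} {x y : ℝ → E}
    (hx : IsSol g a b x) (hy : IsSol g a b y) (h : x a = y a) : ∀ t ∈ Icc a b, x t = y t := by
  intro t ht
  have := dist_le_of_trajectories_ODE hl hy.cont hy.right hx.cont hx.right le_rfl t ht
  rw [h, dist_self, zero_mul] at this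
  exact (dist_le_zero.1 this).symm

lemma IsSol.unique {f : ℝ → E → E} (hf : HasTrunc f) {a b : ℝ} {x y : ℝ → E}
    (hx : IsSol f a b x) (hy : IsSol f a b y) (h : x a = y a) : ∀ t ∈ Icc a b, x t = y t := by
  obtain ⟨R, hR⟩ := hx.bound
  obtain ⟨R', hR'⟩ := hy.bound
  obtain ⟨g, K, C, hc, hl, hb, hg⟩ := hf a b (max R R')
  exact IsSol.unique_aux hl
    (hx.congr_field fun t ht => (hg t ht _ ((hR t ht).trans (le_max_left _ _))).symm)
    (hy.congr_field fun t ht => (hg t ht _ ((hR' t ht).trans (le_max_right _ _))).symm) h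

lemma IsSol.extend [CompleteSpace E] {f : ℝ → E → E} (hf : HasTrunc f) {a b : ℝ} (hab : a ≤ b)
    {x : ℝ → E} (h : IsSol f a b x) :
    ∃ b' > b, ∃ y, IsSol f a b' y ∧ ∀ t ∈ Icc a b, y t = x t := by
  obtain ⟨R, hR⟩ := h.bound
  obtain ⟨g, K, C, hc, hl, hb, hg⟩ := hf a (b + 1) (R + 1)
  have hx : IsSol g a b x := h.congr_field fun t ht =>
    (hg t ⟨ht.1, by linarith [ht.2]⟩ _ ((hR t ht).trans (by linarith))).symm
  obtain ⟨y, hy0, hy⟩ := global_exist hc hl hb (by linarith : a ≤ b + 1) (x a)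
  have hyx := IsSol.unique_aux hl (hy.mono le_rfl (by linarith : b ≤ b + 1)) hx hy0
  have hcb : ContinuousWithinAt (fun t => ‖y t‖) (Icc a (b+1)) b :=
    (hy.cont b ⟨hab, by linarith⟩).norm
  have hlt : ‖y b‖ < R + 1 := by
    rw [hyx b ⟨hab, le_rfl⟩]; linarith [hR b ⟨hab, le_rfl⟩]
  have hev := hcb.eventually (gt_mem_nhds hlt)
  rw [eventually_nhdsWithin_iff, Metric.eventually_nhds_iff] at hev
  obtain ⟨e, he, hev⟩ := hev
  have hm : 0 < min (e/2) 1 := lt_min (by linarith) one_pos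
  have h1 := min_le_left (e/2) 1
  have h2 := min_le_right (e/2) 1
  refine ⟨b + min (e/2) 1, by linarith, y, ?_, hyx⟩
  refine (hy.mono le_rfl (by linarith)).congr_field fun t ht => 
    hg t ⟨ht.1, by linarith [ht.2]⟩ _ ?_
  rcases le_total t b with h3 | h3
  · rw [hyx t ⟨ht.1, h3⟩]; linarith [hR t ⟨ht.1, h3⟩]
  · refine (hev ?_ ⟨ht.1, by linarith [ht.2]⟩).le
    rw [Real.dist_eq, abs_of_nonneg (by linarith)]; linarith [ht.2]

/-- Initial data whose solution stays in `O` until reaching the second set. -/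
def Reach (f : ℝ → E → E) (t₀ : ℝ) (O O' : Set E) : Set E :=
  {z | ∃ T, t₀ ≤ T ∧ ∃ x, x t₀ = z ∧ IsSol f t₀ T x ∧ (∀ t ∈ Icc t₀ T, x t ∈ O) ∧ x T ∈ O'}

lemma isOpen_reach [CompleteSpace E] {f : ℝ → E → E} (hf : HasTrunc f) (t₀ : ℝ) {O O' : Set E}
    (hO : IsOpen O) (hO' : IsOpen O') : IsOpen (Reach f t₀ O O') := by
  rw [Metric.isOpen_iff]
  rintro z ⟨T, hT, x, rfl, hx, hxO, hxO'⟩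
  have hcomp : IsCompact (x '' Icc t₀ T) := isCompact_Icc.image_of_continuousOn hx.cont
  obtain ⟨ε₁, hε₁, h1⟩ := hcomp.exists_thickening_subset_open hO (by rintro _ ⟨t, ht, rfl⟩; exact hxO t ht)
  obtain ⟨ε₂, hε₂, h2⟩ := Metric.isOpen_iff.1 hO' _ hxO'
  obtain ⟨δ, hδ, H⟩ := hx.near hf hT (lt_min hε₁ hε₂)
  refine ⟨δ, hδ, fun z hz => ?_⟩
  obtain ⟨y, hy0, hy, hyd⟩ := H z hz
  refine ⟨T, hT, y, hy0, hy, fun t ht => h1 ?_, h2 ?_⟩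
  · exact Metric.mem_thickening_iff.2 ⟨x t, ⟨t, ht, rfl⟩, (hyd t ht).trans_le (min_le_left _ _)⟩
  · exact (hyd T ⟨hT, le_rfl⟩).trans_le (min_le_right _ _)

end abs

section pend

/-- The pendulum vector field. -/
noncomputable def pend (u : ℝ → ℝ → ℝ → ℝ) (t : ℝ) (z : ℝ × ℝ) : ℝ × ℝ :=
  (z.2, u z.1 z.2 t * sin z.1 - cos z.1)

lemma clamp_lip (R x y : ℝ) : |max (-R) (min R x) - max (-R) (min R y)| ≤ |x - y| := by
  refine (abs_max_sub_max_le_max _ _ _ _).trans (max_le (by simp) ?_)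
  exact (abs_min_sub_min_le_max _ _ _ _).trans (max_le (by simp) le_rfl)

lemma hasTrunc_pend (u : ℝ → ℝ → ℝ → ℝ)
    (hu_cont : Continuous fun x : ℝ × ℝ × ℝ => u x.1 x.2.1 x.2.2)
    (hu_lip : ∀ K : Set (ℝ × ℝ × ℝ), IsCompact K → ∃ L : ℝ,
      ∀ a ∈ K, ∀ b ∈ K, a.2.2 = b.2.2 →
        |u a.1 a.2.1 a.2.2 - u b.1 b.2.1 b.2.2| ≤
          L * dist ((a.1, a.2.1) : ℝ × ℝ) ((b.1, b.2.1) : ℝ × ℝ)) : HasTrunc (pend u) := by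
  intro a b R₀
  set R := |R₀| with hRdef
  have hR : 0 ≤ R := abs_nonneg _
  let K : Set (ℝ × ℝ × ℝ) := Icc (-R) R ×ˢ Icc (-R) R ×ˢ Icc a (max a b)
  have hK : IsCompact K := isCompact_Icc.prod (isCompact_Icc.prod isCompact_Icc)
  obtain ⟨L, hL⟩ := hu_lip K hK
  obtain ⟨M, hM⟩ := hK.exists_bound_of_continuousOn hu_cont.continuousOn
  let c : ℝ → ℝ := fun x => max (-R) (min R x)
  let τ : ℝ → ℝ := fun t => max a (min b t)
  have hc : ∀ x, c x ∈ Icc (-R) R := fun x =>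
    ⟨le_max_left _ _, max_le (by linarith) (min_le_left _ _)⟩
  have hτ : ∀ x, τ x ∈ Icc a (max a b) := fun x =>
    ⟨le_max_left _ _, max_le_max le_rfl (min_le_left _ _)⟩
  have hmem : ∀ x y t, (c x, c y, τ t) ∈ K := fun x y t => ⟨hc x, hc y, hτ t⟩
  have hM0 : 0 ≤ M := (norm_nonneg _).trans (hM _ (hmem 0 0 0))
  have hcd : ∀ x y, |c x - c y| ≤ |x - y| := clamp_lip R
  refine ⟨fun t z => pend u (τ t) (c z.1, c z.2), ⟨|L| + M + 1, by positivity⟩,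
    ⟨R + M + 1, by positivity⟩, ?_, ?_, ?_, ?_⟩
  · intro z
    have : Continuous fun t => u (c z.1) (c z.2) (τ t) :=
      hu_cont.comp (by fun_prop : Continuous fun t => (c z.1, c z.2, τ t))
    unfold pend
    dsimp only
    fun_prop
  · intro t
    refine LipschitzWith.of_dist_le_mul fun z w => ?_
    change dist _ _ ≤ (|L| + M + 1) * dist z w
    have d1 : |z.1 - w.1| ≤ dist z w := by
      rw [← Real.dist_eq, Prod.dist_eq]; exact le_max_left _ _
    have d2 : |z.2 - w.2| ≤ dist z w := by
      rw [← Real.dist_eq, Prod.dist_eq]; exact le_max_right _ _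
    have e1 := (hcd z.1 w.1).trans d1
    have e2 := (hcd z.2 w.2).trans d2
    have hD : 0 ≤ dist z w := dist_nonneg
    have hu1 := hL _ (hmem z.1 z.2 t) _ (hmem w.1 w.2 t) rfl
    have hu2 := hM _ (hmem w.1 w.2 t)
    dsimp only at hu1 hu2
    rw [Real.norm_eq_abs] at hu2
    have e3 : dist ((c z.1, c z.2) : ℝ × ℝ) (c w.1, c w.2) ≤ dist z w := by
      rw [Prod.dist_eq]; exact max_le (by rw [Real.dist_eq]; exact e1) (by rw [Real.dist_eq]; exact e2)
    have hu3 : |u (c z.1) (c z.2) (τ t) - u (c w.1) (c w.2) (τ t)| ≤ |L| * dist z w :=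
      hu1.trans (mul_le_mul (le_abs_self L) e3 dist_nonneg (abs_nonneg _))
    have hs := (abs_sin_sub_sin_le (c z.1) (c w.1)).trans e1
    have hco := (abs_cos_sub_cos_le (c z.1) (c w.1)).trans e1
    rw [Prod.dist_eq]
    refine max_le ?_ ?_
    · rw [Real.dist_eq]
      refine e2.trans ?_
      nlinarith [abs_nonneg L]
    · rw [Real.dist_eq]
      simp only [pend]
      generalize u (c z.1) (c z.2) (τ t) = A at *
      generalize u (c w.1) (c w.2) (τ t) = B at *
      have : A * sin (c z.1) - cos (c z.1) - (B * sin (c w.1) - cos (c w.1)) =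
        (A - B) * sin (c z.1) + B * (sin (c z.1) - sin (c w.1)) - (cos (c z.1) - cos (c w.1)) := by
        ring
      rw [this]
      have t1 : |(A - B) * sin (c z.1)| ≤ |L| * dist z w := by
        rw [abs_mul]
        exact (mul_le_of_le_one_right (abs_nonneg _) (abs_sin_le_one _)).trans hu3
      have t2 : |B * (sin (c z.1) - sin (c w.1))| ≤ M * dist z w := by
        rw [abs_mul]; exact mul_le_mul hu2 hs (abs_nonneg _) hM0
      refine (abs_sub _ _).trans ?_
      have := abs_add_le ((A - B) * sin (c z.1)) (B * (sin (c z.1) - sin (c w.1)))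
      linarith
  · intro t z
    change _ ≤ R + M + 1
    have hu2 := hM _ (hmem z.1 z.2 t)
    dsimp only at hu2
    rw [Real.norm_eq_abs] at hu2
    rw [Prod.norm_def]
    refine max_le ?_ ?_
    · have := abs_le.2 (hc z.2)
      simp only [pend, Real.norm_eq_abs]; linarith
    · simp only [pend, Real.norm_eq_abs]
      refine (abs_sub _ _).trans ?_
      rw [abs_mul]
      have := mul_le_of_le_one_right (abs_nonneg (u (c z.1) (c z.2) (τ t))) (abs_sin_le_one (c z.1))
      have := abs_cos_le_one (c z.1)
      linarith
  · intro t ht z hz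
    have hz' : ‖z‖ ≤ R := hz.trans (le_abs_self _)
    have z1 := abs_le.1 ((norm_fst_le z).trans hz')
    have z2 := abs_le.1 ((norm_snd_le z).trans hz')
    have : c z.1 = z.1 := by simp only [c]; rw [min_eq_right z1.2, max_eq_right z1.1]
    have h2 : c z.2 = z.2 := by simp only [c]; rw [min_eq_right z2.2, max_eq_right z2.1]
    have h3 : τ t = t := by simp only [τ]; rw [min_eq_right ht.2, max_eq_right ht.1]
    simp only [this, h2, h3]

lemma reach_disj {E : Type*} [NormedAddCommGroup E] [NormedSpace ℝ E] {f : ℝ → E → E}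
    (hf : HasTrunc f) {t₀ : ℝ} {O O' P P' : Set E}
    (h1 : ∀ T' T x, t₀ ≤ T' → T' ≤ T → IsSol f t₀ T x → x T' ∈ P' → x T' ∈ O → x T ∉ O')
    (h2 : ∀ z ∈ O', z ∉ P) {z : E} (ha : z ∈ Reach f t₀ O O') : z ∉ Reach f t₀ P P' := by
  rintro ⟨T', hT', y, hy0, hy, hyP, hyP'⟩
  obtain ⟨T, hT, x, hx0, hx, hxO, hxO'⟩ := ha
  rcases le_total T' T with h | h
  · have := (hx.mono le_rfl h).unique hf hy (hx0.trans hy0.symm) T' ⟨hT', le_rfl⟩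
    exact h1 T' T x hT' h hx (this ▸ hyP') (hxO T' ⟨hT', h⟩) hxO'
  · have := hx.unique hf (hy.mono le_rfl h) (hx0.trans hy0.symm) T ⟨hT, le_rfl⟩
    exact h2 _ hxO' (this ▸ hyP T ⟨hT, h⟩)

lemma drop {g h : ℝ → ℝ} {d τ T : ℝ} (hτ : τ < T)
    (hg : ∀ t ∈ Icc τ T, HasDerivWithinAt g (h t) (Icc τ T) t) (hg0 : g τ = 0) (hh : h τ ≤ 0)
    (hd : HasDerivWithinAt h d (Icc τ T) τ) (hd0 : d < 0) :
    ∃ T' ∈ Ioc τ T, g T' < 0 ∧ ∀ t ∈ Icc τ T', g t ≤ 0 := by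
  have h1 := hd.limsup_slope_le hd0
  rw [Icc_sdiff_left, nhdsWithin_Ioc_eq_nhdsGT hτ] at h1
  obtain ⟨s, hs, h2⟩ := (mem_nhdsGT_iff_exists_Ioo_subset).1 h1
  have hs' : τ < s := hs
  obtain ⟨T', hT1, hT2⟩ := exists_between (lt_min hs' hτ)
  have hTs := hT2.trans_le (min_le_left _ _)
  have hTT := hT2.trans_le (min_le_right _ _)
  have hneg : ∀ t ∈ Ioo τ T', h t < 0 := by
    intro t ht
    have h3 : slope h τ t < 0 := h2 ⟨ht.1, ht.2.trans hTs⟩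
    have h4 : 0 < t - τ := sub_pos.2 ht.1
    rw [slope_def_field, div_lt_iff₀ h4] at h3
    linarith
  have hanti : StrictAntiOn g (Icc τ T') := by
    refine strictAntiOn_of_hasDerivWithinAt_neg (convex_Icc _ _) (f' := h) ?_ ?_ ?_
    · exact fun t ht => ((hg t ⟨ht.1, ht.2.trans hTT.le⟩).continuousWithinAt).mono
        (Icc_subset_Icc le_rfl hTT.le)
    · intro t ht
      rw [interior_Icc] at *
      exact (hg t ⟨ht.1.le, (ht.2.trans hTT).le⟩).mono
        (Ioo_subset_Icc_self.trans (Icc_subset_Icc le_rfl hTT.le))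
    · rw [interior_Icc]; exact hneg
  have hl : τ ∈ Icc τ T' := ⟨le_rfl, hT1.le⟩
  refine ⟨T', ⟨hT1, hTT.le⟩, ?_, fun t ht => ?_⟩
  · rw [← hg0]; exact hanti hl ⟨hT1.le, le_rfl⟩ hT1
  · rw [← hg0]; exact hanti.antitoneOn hl ht ht.1

lemma left_deriv {g : ℝ → ℝ} {h a τ : ℝ} (haτ : a < τ) (hg : HasDerivWithinAt g h (Icc a τ) τ)
    (hg0 : g τ = 0) (hpos : ∀ t ∈ Ico a τ, 0 ≤ g t) : h ≤ 0 := by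
  have h1 := hasDerivWithinAt_iff_tendsto_slope.1 hg
  rw [Icc_sdiff_right, nhdsWithin_Ico_eq_nhdsLT haτ] at h1
  refine le_of_tendsto h1 ?_
  filter_upwards [Ico_mem_nhdsLT haτ] with t ht
  rw [slope_def_field, hg0]
  exact div_nonpos_of_nonneg_of_nonpos (by linarith [hpos t ht]) (by linarith [ht.2])

lemma IsSol.fst {u : ℝ → ℝ → ℝ → ℝ} {a b : ℝ} {x : ℝ → ℝ × ℝ} (h : IsSol (pend u) a b x) :
    ∀ t ∈ Icc a b, HasDerivWithinAt (fun t => (x t).1) (x t).2 (Icc a b) t := fun t ht =>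
  (hasFDerivAt_fst (𝕜 := ℝ) (p := x t)).comp_hasDerivWithinAt t (h t ht)

lemma IsSol.snd {u : ℝ → ℝ → ℝ → ℝ} {a b : ℝ} {x : ℝ → ℝ × ℝ} (h : IsSol (pend u) a b x) :
    ∀ t ∈ Icc a b, HasDerivWithinAt (fun t => (x t).2)
      (u (x t).1 (x t).2 t * sin (x t).1 - cos (x t).1) (Icc a b) t := fun t ht =>
  (hasFDerivAt_snd (𝕜 := ℝ) (p := x t)).comp_hasDerivWithinAt t (h t ht)

lemma exit_left {u : ℝ → ℝ → ℝ → ℝ} (hf : HasTrunc (pend u)) {a b : ℝ} (hab : a ≤ b)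
    {x : ℝ → ℝ × ℝ} (h : IsSol (pend u) a b x) (hlt : ∀ t ∈ Icc a b, (x t).1 < π)
    (h0 : (x b).1 = 0) (hp : (x b).2 ≤ 0) :
    x a ∈ Reach (pend u) a {z | z.1 < π} {z | z.1 < 0} := by
  obtain ⟨b', hb', y, hy, hyx⟩ := h.extend hf hab
  have hb := hyx b ⟨hab, le_rfl⟩
  have hy2 := hy.mono hab le_rfl
  obtain ⟨T, hT, hT0, hT1⟩ := drop hb' hy2.fst (by rw [hb]; exact h0) (by rw [hb]; exact hp)
    (hy2.snd b ⟨le_rfl, hb'.le⟩) (by rw [hb, h0]; simp)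
  refine ⟨T, hab.trans hT.1.le, y, hyx a ⟨le_rfl, hab⟩, hy.mono le_rfl hT.2, fun t ht => ?_, hT0⟩
  rcases le_total t b with h3 | h3
  · rw [hyx t ⟨ht.1, h3⟩]; exact hlt t ⟨ht.1, h3⟩
  · exact (hT1 t ⟨h3, ht.2⟩).trans_lt pi_pos

lemma exit_right {u : ℝ → ℝ → ℝ → ℝ} (hf : HasTrunc (pend u)) {a b : ℝ} (hab : a ≤ b)
    {x : ℝ → ℝ × ℝ} (h : IsSol (pend u) a b x) (hlt : ∀ t ∈ Icc a b, 0 < (x t).1)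
    (h0 : (x b).1 = π) (hp : 0 ≤ (x b).2) :
    x a ∈ Reach (pend u) a {z | 0 < z.1} {z | π < z.1} := by
  obtain ⟨b', hb', y, hy, hyx⟩ := h.extend hf hab
  have hb := hyx b ⟨hab, le_rfl⟩
  have hy2 := hy.mono hab le_rfl
  obtain ⟨T, hT, hT0, hT1⟩ := drop (g := fun t => π - (y t).1) (h := fun t => -(y t).2) hb'
    (fun t ht => (hy2.fst t ht).const_sub π) (by rw [hb, h0]; simp)
    (by rw [hb]; linarith)
    (hy2.snd b ⟨le_rfl, hb'.le⟩).neg (by rw [hb, h0]; simp)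
  refine ⟨T, hab.trans hT.1.le, y, hyx a ⟨le_rfl, hab⟩, hy.mono le_rfl hT.2, fun t ht => ?_,
    by simpa using hT0⟩
  rcases le_total t b with h3 | h3
  · rw [hyx t ⟨ht.1, h3⟩]; exact hlt t ⟨ht.1, h3⟩
  · have := hT1 t ⟨h3, ht.2⟩
    simp only [mem_ofPred_eq]
    linarith [pi_pos]

/-- A solution that leaves the strip belongs to one of the two exit sets. -/
lemma exits {u : ℝ → ℝ → ℝ → ℝ} (hf : HasTrunc (pend u)) {a b : ℝ} (hab : a ≤ b)
    {x : ℝ → ℝ × ℝ} (h : IsSol (pend u) a b x) (h0 : 0 < (x a).1) (h0' : (x a).1 < π)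
    (hb : ¬ (0 < (x b).1 ∧ (x b).1 < π)) :
    x a ∈ Reach (pend u) a {z | z.1 < π} {z | z.1 < 0} ∨
    x a ∈ Reach (pend u) a {z | 0 < z.1} {z | π < z.1} := by
  have hc : ContinuousOn (fun t => (x t).1) (Icc a b) := continuous_fst.comp_continuousOn h.cont
  let S : Set ℝ := Icc a b ∩ (fun t => (x t).1) ⁻¹' (Iic 0 ∪ Ici π)
  have hS : IsCompact S := isCompact_Icc.of_isClosed_subset
    (hc.preimage_isClosed_of_isClosed isClosed_Icc (isClosed_Iic.union isClosed_Ici))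
    inter_subset_left
  have hbS : b ∈ S := by
    refine ⟨⟨hab, le_rfl⟩, ?_⟩
    by_contra hcon
    simp only [mem_preimage, mem_union, mem_Iic, mem_Ici, not_or, not_le] at hcon
    exact hb hcon
  obtain ⟨τ, hτS, hτ⟩ := hS.exists_isLeast ⟨b, hbS⟩
  have haτ : a ≤ τ := hτS.1.1
  have hτb : τ ≤ b := hτS.1.2
  have hbef : ∀ t ∈ Ico a τ, 0 < (x t).1 ∧ (x t).1 < π := by
    intro t ht
    by_contra hcon
    refine absurd (hτ ⟨⟨ht.1, ht.2.le.trans hτb⟩, ?_⟩) (not_le.2 ht.2)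
    simp only [mem_preimage, mem_union, mem_Iic, mem_Ici]
    by_contra h5
    push Not at h5
    exact hcon h5
  have hxτ := h.mono le_rfl hτb
  have hcτ := hc.mono (Icc_subset_Icc le_rfl hτb)
  rcases hτS.2 with h1 | h1
  · left
    simp only [mem_Iic] at h1
    have hne : a < τ := lt_of_le_of_ne haτ (by rintro rfl; linarith)
    have hq : (x τ).1 = 0 := by
      obtain ⟨s, hs, hs0⟩ := intermediate_value_Icc' haτ hcτ ⟨h1, h0.le⟩
      rcases hs.2.eq_or_lt with rfl | hlt
      · exact hs0
      · exact absurd hs0 (hbef s ⟨hs.1, hlt⟩).1.ne'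
    refine exit_left hf haτ hxτ (fun t ht => ?_) hq
      (left_deriv hne (hxτ.fst τ ⟨haτ, le_rfl⟩) hq fun t ht => (hbef t ht).1.le)
    rcases ht.2.eq_or_lt with rfl | hlt
    · rw [hq]; exact pi_pos
    · exact (hbef t ⟨ht.1, hlt⟩).2
  · right
    simp only [mem_Ici] at h1
    have hne : a < τ := lt_of_le_of_ne haτ (by rintro rfl; linarith)
    have hq : (x τ).1 = π := by
      obtain ⟨s, hs, hs0⟩ := intermediate_value_Icc haτ hcτ ⟨h0'.le, h1⟩
      rcases hs.2.eq_or_lt with rfl | hlt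
      · exact hs0
      · exact absurd hs0 (hbef s ⟨hs.1, hlt⟩).2.ne
    refine exit_right hf haτ hxτ (fun t ht => ?_) hq
      (neg_nonpos.1 (left_deriv hne ((hxτ.fst τ ⟨haτ, le_rfl⟩).const_sub π) (by rw [hq]; simp)
        fun t ht => by linarith [(hbef t ht).2]))
    rcases ht.2.eq_or_lt with rfl | hlt
    · rw [hq]; exact pi_pos
    · exact (hbef t ⟨ht.1, hlt⟩).1

/-- Positive invariance of the sublevel set of the Lyapunov function. -/
lemma invariant {E : Type*} [NormedAddCommGroup E] [NormedSpace ℝ E] {f : ℝ → E → E}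
    {V : E → ℝ} {DV : E → E →L[ℝ] ℝ} {m : E} {r c : ℝ}
    (hV : ∀ z ∈ Metric.closedBall m r, HasFDerivAt V (DV z) z)
    (hneg : ∀ t, ∀ z ∈ Metric.closedBall m r, DV z (f t z) ≤ 0)
    (hsph : ∀ z ∈ Metric.sphere m r, c ≤ V z)
    (hBo : IsOpen (Metric.ball m r ∩ {z | V z < c}))
    {a b : ℝ} (hab : a ≤ b) {x : ℝ → E} (h : IsSol f a b x)
    (ha : x a ∈ Metric.ball m r ∩ {z | V z < c}) : x b ∈ Metric.ball m r ∩ {z | V z < c} := by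
  set B := Metric.ball m r ∩ {z | V z < c} with hB
  by_contra hcon
  let S : Set ℝ := Icc a b ∩ x ⁻¹' Bᶜ
  have hS : IsCompact S := isCompact_Icc.of_isClosed_subset
    (h.cont.preimage_isClosed_of_isClosed isClosed_Icc hBo.isClosed_compl) inter_subset_left
  obtain ⟨τ, hτS, hτ⟩ := hS.exists_isLeast ⟨b, ⟨hab, le_rfl⟩, hcon⟩
  have haτ : a ≤ τ := hτS.1.1
  have hτb : τ ≤ b := hτS.1.2
  have hne : a < τ := lt_of_le_of_ne haτ (by rintro rfl; exact hτS.2 ha)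
  have hbef : ∀ t ∈ Ico a τ, x t ∈ B := by
    intro t ht
    by_contra h3
    exact absurd (hτ ⟨⟨ht.1, ht.2.le.trans hτb⟩, h3⟩) (not_le.2 ht.2)
  have hxτ := h.mono le_rfl hτb
  have hcl : ∀ t ∈ Icc a τ, x t ∈ Metric.closedBall m r := by
    have h5 : MapsTo x (closure (Ico a τ)) (closure (Metric.closedBall m r)) := by
      refine MapsTo.closure_of_continuousOn (fun t ht => Metric.ball_subset_closedBall (hbef t ht).1) ?_
      rw [closure_Ico hne.ne]; exact hxτ.cont
    rw [closure_Ico hne.ne, Metric.isClosed_closedBall.closure_eq] at h5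
    exact h5
  have hd : ∀ t ∈ Icc a τ, HasDerivWithinAt (fun t => V (x t)) (DV (x t) (f t (x t))) (Icc a τ) t :=
    fun t ht => (hV _ (hcl t ht)).comp_hasDerivWithinAt t (hxτ t ht)
  have hanti : AntitoneOn (fun t => V (x t)) (Icc a τ) := by
    refine antitoneOn_of_hasDerivWithinAt_nonpos (convex_Icc _ _)
      (fun t ht => (hd t ht).continuousWithinAt)
      (fun t ht => (hd t (interior_subset ht)).mono interior_subset)
      (fun t ht => hneg t _ (hcl t (interior_subset ht)))
  have hle : V (x τ) ≤ V (x a) := hanti ⟨le_rfl, haτ⟩ ⟨haτ, le_rfl⟩ haτ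
  have hlt : V (x τ) < c := hle.trans_lt ha.2
  refine hτS.2 ⟨?_, hlt⟩
  rcases (Metric.mem_closedBall.1 (hcl τ ⟨haτ, le_rfl⟩)).eq_or_lt with h6 | h6
  · exact absurd (hsph _ h6) (not_le.2 hlt)
  · exact h6

end pend


/-- For the controlled inverted pendulum `q̇ = p, ṗ = u(q,p,t)·sin q − cos q` with a control `u`
continuous in all variables and locally Lipschitz in `(q,p)`, if `μ = (q*, 0)` with
`0 < q* < π` is an equilibrium admitting a Lyapunov function `V` satisfying L1 and L2 on a
closed set `U ⊆ M = {0 < q < π}` with `μ` in its interior, then there are an initial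
condition `(q₀,p₀)` at time `t₀` with `0 < q₀ < π` and an open neighborhood `B ⊆ M` of `μ`
such that every solution starting there stays in `M \ B` for all `t ≥ t₀` in its interval
of existence. -/
theorem inverted_pendulum_no_global_stabilization
    (u : ℝ → ℝ → ℝ → ℝ)
    (hu_cont : Continuous fun x : ℝ × ℝ × ℝ => u x.1 x.2.1 x.2.2)
    (hu_lip : ∀ K : Set (ℝ × ℝ × ℝ), IsCompact K → ∃ L : ℝ,
      ∀ a ∈ K, ∀ b ∈ K, a.2.2 = b.2.2 →
        |u a.1 a.2.1 a.2.2 - u b.1 b.2.1 b.2.2| ≤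
          L * dist ((a.1, a.2.1) : ℝ × ℝ) ((b.1, b.2.1) : ℝ × ℝ))
    (qstar : ℝ) (hq1 : 0 < qstar) (hq2 : qstar < π)
    (hequil : ∀ t : ℝ, u qstar 0 t * sin qstar - cos qstar = 0)
    (t₀ : ℝ)
    (U : Set (ℝ × ℝ)) (hUclosed : IsClosed U)
    (hUM : U ⊆ {z : ℝ × ℝ | 0 < z.1 ∧ z.1 < π})
    (hμint : (qstar, (0 : ℝ)) ∈ interior U)
    (V : ℝ × ℝ → ℝ) (DV : ℝ × ℝ → (ℝ × ℝ) →L[ℝ] ℝ)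
    (hVdiff : ∀ z ∈ U, HasFDerivAt V (DV z) z)
    (hDVcont : ContinuousOn DV U)
    (hL1a : V (qstar, 0) = 0)
    (hL1b : ∀ z ∈ U, z ≠ (qstar, (0 : ℝ)) → 0 < V z)
    (hL2 : ∀ t : ℝ, ∀ z ∈ U, z ≠ (qstar, (0 : ℝ)) →
      DV z (z.2, u z.1 z.2 t * sin z.1 - cos z.1) < 0) :
    ∃ (q₀ p₀ : ℝ) (B : Set (ℝ × ℝ)),
      0 < q₀ ∧ q₀ < π ∧
      IsOpen B ∧ (qstar, (0 : ℝ)) ∈ B ∧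
      B ⊆ {z : ℝ × ℝ | 0 < z.1 ∧ z.1 < π} ∧
      ∀ I : Set ℝ, t₀ ∈ I → I.OrdConnected →
        ∀ q p : ℝ → ℝ,
          (∀ t ∈ I, HasDerivWithinAt q (p t) I t) →
          (∀ t ∈ I, HasDerivWithinAt p
            (u (q t) (p t) t * sin (q t) - cos (q t)) I t) →
          q t₀ = q₀ → p t₀ = p₀ →
          ∀ t ∈ I, t₀ ≤ t →
            (0 < q t ∧ q t < π) ∧ (q t, p t) ∉ B := by
  have hf := hasTrunc_pend u hu_cont hu_lip
  obtain ⟨r, hr, hrU⟩ := Metric.nhds_basis_closedBall.mem_iff.1 (mem_interior_iff_mem_nhds.1 hμint)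
  have hVc : ContinuousOn V (Metric.closedBall (qstar, (0:ℝ)) r) := fun z hz =>
    (hVdiff z (hrU hz)).continuousAt.continuousWithinAt
  have hcpt : IsCompact (Metric.sphere ((qstar, 0) : ℝ × ℝ) r) := isCompact_sphere _ _
  have hnes : (Metric.sphere ((qstar, 0) : ℝ × ℝ) r).Nonempty := NormedSpace.sphere_nonempty.2 hr.le
  obtain ⟨z₁, hz₁, hmin⟩ := hcpt.exists_isMinOn hnes (hVc.mono Metric.sphere_subset_closedBall)
  have hc : 0 < V z₁ := hL1b z₁ (hrU (Metric.sphere_subset_closedBall hz₁)) (by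
    rintro rfl
    simp at hz₁
    linarith)
  let B : Set (ℝ × ℝ) := Metric.ball (qstar, 0) r ∩ {z | V z < V z₁}
  have hBo : IsOpen B := 
    (hVc.mono Metric.ball_subset_closedBall).isOpen_inter_preimage Metric.isOpen_ball isOpen_Iio
  have hBM : B ⊆ {z : ℝ × ℝ | 0 < z.1 ∧ z.1 < π} := fun z hz =>
    hUM (hrU (Metric.ball_subset_closedBall hz.1))
  have hμB : (qstar, (0:ℝ)) ∈ B := ⟨Metric.mem_ball_self hr, by simpa [hL1a] using hc⟩
  have hinv : ∀ a b : ℝ, a ≤ b → ∀ x, IsSol (pend u) a b x → x a ∈ B → x b ∈ B := by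
    intro a b hab x hx hxa
    refine invariant (fun z hz => hVdiff z (hrU hz)) (fun t z hz => ?_) (fun z hz => hmin hz) hBo
      hab hx hxa
    by_cases hz0 : z = (qstar, 0)
    · subst hz0
      have : pend u t (qstar, 0) = 0 := by
        simp only [pend, hequil t]; rfl
      rw [this, map_zero]
    · exact (hL2 t z (hrU hz) hz0).le
  let AL := Reach (pend u) t₀ {z | z.1 < π} {z | z.1 < 0}
  let AR := Reach (pend u) t₀ {z | 0 < z.1} {z | π < z.1}
  let AB := Reach (pend u) t₀ {z | 0 < z.1 ∧ z.1 < π} B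
  have o1 : IsOpen {z : ℝ × ℝ | z.1 < π} := isOpen_lt continuous_fst continuous_const
  have o2 : IsOpen {z : ℝ × ℝ | z.1 < 0} := isOpen_lt continuous_fst continuous_const
  have o3 : IsOpen {z : ℝ × ℝ | 0 < z.1} := isOpen_lt continuous_const continuous_fst
  have o4 : IsOpen {z : ℝ × ℝ | π < z.1} := isOpen_lt continuous_const continuous_fst
  have hAL : IsOpen AL := isOpen_reach hf t₀ o1 o2
  have hAR : IsOpen AR := isOpen_reach hf t₀ o3 o4
  have hAB : IsOpen AB := isOpen_reach hf t₀ (o3.inter o1) hBo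
  have dLR : ∀ z ∈ AL, z ∉ AR := fun z hz => reach_disj hf
    (fun T' T x _ _ _ h1 h2 => by
      simp only [mem_ofPred_eq] at h1 h2; linarith)
    (fun z h1 h2 => by simp only [mem_ofPred_eq] at h1 h2; linarith) hz
  have dLB : ∀ z ∈ AL, z ∉ AB := fun z hz => reach_disj hf
    (fun T' T x hT' hT hx h1 h2 h3 => absurd (hBM (hinv T' T hT x (hx.mono hT' le_rfl) h1)).1
      (not_lt.2 (le_of_lt h3)))
    (fun z h1 h2 => absurd h2.1 (not_lt.2 (le_of_lt h1))) hz
  let γ : ℝ → ℝ × ℝ := fun s => (s * qstar, s - 1)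
  have hγ : Continuous γ := by fun_prop
  have hsing : ∀ z : ℝ × ℝ, IsSol (pend u) t₀ t₀ (fun _ => z) := by
    intro z t ht
    rw [Icc_self] at *
    rw [mem_singleton_iff.1 ht]
    rw [hasDerivWithinAt_iff_tendsto_slope]
    simp
  have h0 : γ 0 ∈ AL := exit_left hf le_rfl (hsing (γ 0)) (fun t _ => by simp [γ, pi_pos])
    (by simp [γ]) (by simp [γ])
  have h1 : γ 1 ∈ AB := by
    refine ⟨t₀, le_rfl, fun _ => γ 1, rfl, hsing _, fun t _ => ?_, ?_⟩
    · simp [γ, hq1, hq2]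
    · simpa [γ] using hμB
  obtain ⟨s, hs, hsn⟩ : ∃ s ∈ Icc (0:ℝ) 1, ¬ (γ s ∈ AL ∨ γ s ∈ AR ∪ AB) := by
    by_contra! hcon
    obtain ⟨s, -, h2, h3⟩ := isPreconnected_Icc (γ ⁻¹' AL) (γ ⁻¹' (AR ∪ AB)) (hAL.preimage hγ)
      ((hAR.union hAB).preimage hγ) (fun s hs => hcon s hs)
      ⟨0, ⟨le_rfl, zero_le_one⟩, h0⟩ ⟨1, ⟨zero_le_one, le_rfl⟩, Or.inr h1⟩
    rcases h3 with h3 | h3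
    · exact dLR _ h2 h3
    · exact dLB _ h2 h3
  rw [not_or, mem_union, not_or] at hsn
  obtain ⟨nL, nR, nB⟩ := hsn
  have hs0 : 0 < s := lt_of_le_of_ne hs.1 (by rintro rfl; exact nL h0)
  have hp1 : 0 < s * qstar := by positivity
  have hp2 : s * qstar < π := by nlinarith [hs.2]
  refine ⟨s * qstar, s - 1, B, hp1, hp2, hBo, hμB, hBM, ?_⟩
  intro I ht₀ hI q p hq hp hq0 hp0 t ht htt
  let x : ℝ → ℝ × ℝ := fun t => (q t, p t)
  have hsol : ∀ b ∈ I, IsSol (pend u) t₀ b x := by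
    intro b hb τ hτ
    have hsub : Icc t₀ b ⊆ I := hI.out ht₀ hb
    exact ((hq τ (hsub hτ)).prodMk (hp τ (hsub hτ))).mono hsub
  have hx0 : x t₀ = γ s := by simp only [x, γ, hq0, hp0]
  have hstrip : ∀ b ∈ I, t₀ ≤ b → 0 < q b ∧ q b < π := by
    intro b hb htb
    by_contra hcon
    have := exits hf htb (hsol b hb) (by rw [hx0]; exact hp1) (by rw [hx0]; exact hp2) hcon
    rw [hx0] at this
    exact this.elim nL nR
  refine ⟨hstrip t ht htt, fun hB => nB ⟨t, htt, x, hx0, hsol t ht, fun τ hτ => ?_, hB⟩⟩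
  exact hstrip τ (hI.out ht₀ ht hτ) hτ.1
end

section
/- Let u : ℝ³ → ℝ be bounded, continuous in all variables, locally Lipschitz in (q,p), and T-periodic in t (u(q,p,t+T) = u(q,p,t) for all (q,p,t)), and let ν > 0. Then there exists an initial condition (q₀, p₀) with 0 < q₀ < π such that the solution (q(t), p(t)) of the damped system q̇ = p, ṗ = u(q,p,t)·sin q − cos q − ν·p with (q(0), p(0)) = (q₀, p₀) is defined for all t ∈ ℝ, is T-periodic (q(t+T) = q(t) and p(t+T) = p(t) for all t), and satisfies 0 < q(t) < π for all t. -/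
open Real Set

namespace Pend
open MeasureTheory Filter Topology

/-- The bounded solution operator of `A' = h - k A`. -/
noncomputable def J (k : ℝ) (h : ℝ → ℝ) (t : ℝ) : ℝ :=
  exp (-(k * t)) * ∫ s in Iic t, exp (k * s) * h s

def Adm (c : ℝ) (h : ℝ → ℝ) : Prop := Measurable h ∧ ∀ t, 0 ≤ h t ∧ h t ≤ c

lemma Adm.neg {c : ℝ} {h : ℝ → ℝ} (H : Adm c h) : Adm c (fun t => h (-t)) :=
  ⟨H.1.comp measurable_neg, fun _ => H.2 _⟩

lemma intOn {k c : ℝ} (hk : 0 < k) {h : ℝ → ℝ} (H : Adm c h) (t : ℝ) :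
    IntegrableOn (fun s => exp (k * s) * h s) (Iic t) := by
  have h1 := (integrableOn_exp_mul_Iic hk t).mul_const c
  refine Integrable.mono' h1 ?_ ?_
  · exact ((by fun_prop : Measurable fun s : ℝ => exp (k * s)).mul H.1).aestronglyMeasurable
  · refine Eventually.of_forall fun s => ?_
    rw [norm_mul, Real.norm_eq_abs, abs_of_pos (exp_pos _), Real.norm_eq_abs,
      abs_of_nonneg (H.2 s).1]
    exact mul_le_mul_of_nonneg_left (H.2 s).2 (exp_pos _).le

lemma J_mono {k c : ℝ} (hk : 0 < k) {h g : ℝ → ℝ} (H : Adm c h) (G : Adm c g)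
    (hg : ∀ t, h t ≤ g t) (t : ℝ) : J k h t ≤ J k g t := by
  unfold J
  refine mul_le_mul_of_nonneg_left ?_ (exp_pos _).le
  exact setIntegral_mono (intOn hk H t) (intOn hk G t)
    fun s => mul_le_mul_of_nonneg_left (hg s) (exp_pos _).le

lemma J_const {k : ℝ} (hk : 0 < k) (c t : ℝ) : J k (fun _ => c) t = c / k := by
  unfold J
  rw [integral_mul_const, integral_exp_mul_Iic hk, exp_neg]
  have := exp_pos (k * t)
  field_simp

lemma J_bd {k c : ℝ} (hk : 0 < k) {h : ℝ → ℝ} (H : Adm c h) (t : ℝ) :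
    0 ≤ J k h t ∧ J k h t ≤ c / k := by
  have hc : 0 ≤ c := (H.2 0).1.trans (H.2 0).2
  constructor
  · have := J_mono hk (h := fun _ => 0) (g := h) (c := c)
      ⟨measurable_const, fun t => ⟨le_rfl, hc⟩⟩ H (fun t => (H.2 t).1) t
    rw [J_const hk] at this
    simpa using this
  · rw [← J_const hk c t]
    exact J_mono hk H ⟨measurable_const, fun t => ⟨hc, le_rfl⟩⟩ (fun t => (H.2 t).2) t

lemma J_eq {k c : ℝ} (hk : 0 < k) {h : ℝ → ℝ} (H : Adm c h) :
    J k h = fun t => exp (-(k * t)) *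
      ((∫ s in Iic (0:ℝ), exp (k * s) * h s) + ∫ s in (0:ℝ)..t, exp (k * s) * h s) := by
  funext t
  rw [← intervalIntegral.integral_Iic_sub_Iic (intOn hk H 0) (intOn hk H t)]
  unfold J
  ring

lemma J_ii {k c : ℝ} (hk : 0 < k) {h : ℝ → ℝ} (H : Adm c h) (a b : ℝ) :
    IntervalIntegrable (fun s => exp (k * s) * h s) volume a b := by
  rw [intervalIntegrable_iff]
  refine (intOn hk H (max a b)).mono_set ?_
  intro x hx
  exact hx.2

lemma J_cont {k c : ℝ} (hk : 0 < k) {h : ℝ → ℝ} (H : Adm c h) : Continuous (J k h) := by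
  rw [J_eq hk H]
  have := intervalIntegral.continuous_primitive (J_ii hk H) 0
  fun_prop

lemma J_deriv {k c : ℝ} (hk : 0 < k) {h : ℝ → ℝ} (H : Adm c h) (hc : Continuous h) (t : ℝ) :
    HasDerivAt (J k h) (h t - k * J k h t) t := by
  have e : J k h t = _ := congrFun (J_eq hk H) t
  rw [e, J_eq hk H]
  have hcc : Continuous (fun s => exp (k * s) * h s) := by fun_prop
  have h1 := intervalIntegral.integral_hasDerivAt_right (J_ii hk H 0 t)
    (hcc.stronglyMeasurableAtFilter _ _) hcc.continuousAt
  have h2 : HasDerivAt (fun t : ℝ => exp (-(k * t))) (exp (-(k * t)) * (-(k * 1))) t :=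
    (((hasDerivAt_id t).const_mul k).neg).exp
  have h3 := h2.mul (h1.const_add (∫ s in Iic (0:ℝ), exp (k * s) * h s))
  refine HasDerivAt.congr_deriv h3 ?_
  have : exp (-(k * t)) * exp (k * t) = 1 := by rw [← exp_add]; simp
  linear_combination (h t) * this

lemma J_per {k T : ℝ} {h : ℝ → ℝ} (hp : ∀ t, h (t + T) = h t) (t : ℝ) :
    J k h (t + T) = J k h t := by
  unfold J
  have := (measurePreserving_add_right (volume : Measure ℝ) T).setIntegral_preimage_emb
    (MeasurableEquiv.addRight T).measurableEmbedding (fun s => exp (k * s) * h s) (Iic (t + T))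
  rw [← this]
  have e : (fun x => x + T) ⁻¹' Iic (t + T) = Iic t := by ext; simp
  rw [e]
  simp only [hp]
  have : ∀ s, exp (k * (s + T)) * h s = exp (k * T) * (exp (k * s) * h s) := by
    intro s; rw [mul_add, exp_add]; ring
  simp only [this]
  rw [integral_const_mul, ← mul_assoc, ← exp_add]
  congr 2; ring

lemma J_tendsto {k c : ℝ} (hk : 0 < k) {hn : ℕ → ℝ → ℝ} {h : ℝ → ℝ} (H : ∀ n, Adm c (hn n))
    (hl : ∀ t, Tendsto (fun n => hn n t) atTop (𝓝 (h t))) (t : ℝ) :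
    Tendsto (fun n => J k (hn n) t) atTop (𝓝 (J k h t)) := by
  unfold J
  refine Tendsto.const_mul _ ?_
  refine tendsto_integral_of_dominated_convergence (fun s => exp (k * s) * c)
    (fun n => (intOn hk (H n) t).aestronglyMeasurable)
    ((integrableOn_exp_mul_Iic hk t).mul_const c) ?_ ?_
  · refine fun n => Eventually.of_forall fun s => ?_
    rw [norm_mul, Real.norm_eq_abs, abs_of_pos (exp_pos _), Real.norm_eq_abs,
      abs_of_nonneg ((H n).2 s).1]
    exact mul_le_mul_of_nonneg_left ((H n).2 s).2 (exp_pos _).le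
  · exact Eventually.of_forall fun s => (hl s).const_mul _

/-- The monotone iteration. -/
noncomputable def X (k : ℝ) (H : ℝ → ℝ → ℝ → ℝ) : ℕ → (ℝ → ℝ) × (ℝ → ℝ)
  | 0 => (fun _ => 0, fun _ => 0)
  | n + 1 => (J k (fun t => H t ((X k H n).1 t) ((X k H n).2 t)),
      fun t => J k (fun t => H (-t) ((X k H n).1 (-t)) ((X k H n).2 (-t))) (-t))

theorem exists_AB (k N T : ℝ) (hk : 0 < k) (hN : 0 ≤ N) (H : ℝ → ℝ → ℝ → ℝ)
    (Hc : Continuous fun x : ℝ × ℝ × ℝ => H x.1 x.2.1 x.2.2)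
    (Hm : ∀ t a b a' b', a ≤ a' → b ≤ b' → H t a b ≤ H t a' b')
    (Hp : ∀ t a b, H (t + T) a b = H t a b)
    (H0 : ∀ t, 0 ≤ H t 0 0) (H1 : ∀ t, H t N N ≤ k * N) :
    ∃ A B : ℝ → ℝ, (∀ t, 0 ≤ A t ∧ A t ≤ N) ∧ (∀ t, 0 ≤ B t ∧ B t ≤ N) ∧
      (∀ t, A (t + T) = A t) ∧ (∀ t, B (t + T) = B t) ∧
      (∀ t, HasDerivAt A (H t (A t) (B t) - k * A t) t) ∧
      (∀ t, HasDerivAt B (k * B t - H t (A t) (B t)) t) := by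
  have Hcomp : ∀ A B : ℝ → ℝ, Continuous A → Continuous B →
      Continuous (fun t => H t (A t) (B t)) := by
    intro A B hA hB
    exact Hc.comp (continuous_id.prodMk (hA.prodMk hB))
  have Hmeas : ∀ A B : ℝ → ℝ, Measurable A → Measurable B →
      Measurable (fun t => H t (A t) (B t)) := by
    intro A B hA hB
    exact Hc.measurable.comp (measurable_id.prodMk (hA.prodMk hB))
  have Hbd : ∀ A B : ℝ → ℝ, Measurable A → Measurable B → (∀ t, 0 ≤ A t ∧ A t ≤ N) →
      (∀ t, 0 ≤ B t ∧ B t ≤ N) → Adm (k * N) (fun t => H t (A t) (B t)) := by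
    intro A B hA hB h1 h2
    refine ⟨Hmeas A B hA hB, fun t => ⟨(H0 t).trans (Hm _ _ _ _ _ (h1 t).1 (h2 t).1),
      (Hm _ _ _ _ _ (h1 t).2 (h2 t).2).trans (H1 t)⟩⟩
  have kN : k * N / k = N := by field_simp
  have main : ∀ n, (Measurable (X k H n).1 ∧ Measurable (X k H n).2) ∧
      (∀ t, 0 ≤ (X k H n).1 t ∧ (X k H n).1 t ≤ N) ∧
      (∀ t, 0 ≤ (X k H n).2 t ∧ (X k H n).2 t ≤ N) ∧
      (∀ t, (X k H n).1 (t + T) = (X k H n).1 t) ∧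
      (∀ t, (X k H n).2 (t + T) = (X k H n).2 t) := by
    intro n
    induction n with
    | zero => simp [X, hN]
    | succ n ih =>
      obtain ⟨⟨m1, m2⟩, b1, b2, p1, p2⟩ := ih
      have ad := Hbd _ _ m1 m2 b1 b2
      refine ⟨⟨(J_cont hk ad).measurable,
        ((J_cont hk ad.neg).comp continuous_neg).measurable⟩, ?_, ?_, ?_, ?_⟩
      · intro t; have := J_bd hk ad t; rwa [kN] at this
      · intro t; have := J_bd hk ad.neg (-t); rwa [kN] at this
      · intro t
        exact J_per (fun t => by simp only [p1, p2, Hp]) t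
      · intro t
        have := J_per (k := k) (T := T)
          (h := fun t => H (-t) ((X k H n).1 (-t)) ((X k H n).2 (-t))) (fun t => by
            have e : -t = -(t + T) + T := by ring
            conv_rhs => rw [e, Hp, p1, p2]) (-(t + T))
        have e : -(t + T) + T = -t := by ring
        rw [e] at this
        exact this.symm
  have ad : ∀ n, Adm (k * N) (fun t => H t ((X k H n).1 t) ((X k H n).2 t)) := fun n =>
    Hbd _ _ (main n).1.1 (main n).1.2 (main n).2.1 (main n).2.2.1
  have mono : ∀ n, (∀ t, (X k H n).1 t ≤ (X k H (n+1)).1 t) ∧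
      (∀ t, (X k H n).2 t ≤ (X k H (n+1)).2 t) := by
    intro n
    induction n with
    | zero => exact ⟨fun t => ((main 1).2.1 t).1, fun t => ((main 1).2.2.1 t).1⟩
    | succ n ih =>
      exact ⟨fun t => J_mono hk (ad n) (ad (n+1)) (fun t => Hm _ _ _ _ _ (ih.1 t) (ih.2 t)) t,
        fun t => J_mono hk (ad n).neg (ad (n+1)).neg
          (fun t => Hm _ _ _ _ _ (ih.1 _) (ih.2 _)) (-t)⟩
  have l1 : ∀ t, ∃ a, Tendsto (fun n => (X k H n).1 t) atTop (𝓝 a) := fun t =>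
    ⟨_, tendsto_atTop_ciSup (monotone_nat_of_le_succ fun n => (mono n).1 t)
      ⟨N, by rintro _ ⟨n, rfl⟩; exact ((main n).2.1 t).2⟩⟩
  have l2 : ∀ t, ∃ a, Tendsto (fun n => (X k H n).2 t) atTop (𝓝 a) := fun t =>
    ⟨_, tendsto_atTop_ciSup (monotone_nat_of_le_succ fun n => (mono n).2 t)
      ⟨N, by rintro _ ⟨n, rfl⟩; exact ((main n).2.2.1 t).2⟩⟩
  choose A hA using l1
  choose B hB using l2
  have mA : Measurable A := measurable_of_tendsto_metrizable (fun n => (main n).1.1)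
    (tendsto_pi_nhds.2 hA)
  have mB : Measurable B := measurable_of_tendsto_metrizable (fun n => (main n).1.2)
    (tendsto_pi_nhds.2 hB)
  have bA : ∀ t, 0 ≤ A t ∧ A t ≤ N := fun t =>
    ⟨ge_of_tendsto' (hA t) fun n => ((main n).2.1 t).1,
      le_of_tendsto' (hA t) fun n => ((main n).2.1 t).2⟩
  have bB : ∀ t, 0 ≤ B t ∧ B t ≤ N := fun t =>
    ⟨ge_of_tendsto' (hB t) fun n => ((main n).2.2.1 t).1,
      le_of_tendsto' (hB t) fun n => ((main n).2.2.1 t).2⟩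
  have adm := Hbd A B mA mB bA bB
  have lim : ∀ t, Tendsto (fun n => H t ((X k H n).1 t) ((X k H n).2 t)) atTop
      (𝓝 (H t (A t) (B t))) := fun t =>
    (Hc.tendsto (t, A t, B t)).comp
      (tendsto_const_nhds.prodMk_nhds ((hA t).prodMk_nhds (hB t)))
  have eA : A = J k (fun t => H t (A t) (B t)) := by
    funext t
    exact tendsto_nhds_unique ((tendsto_add_atTop_iff_nat 1).2 (hA t))
      (J_tendsto hk ad lim t)
  have eB : B = fun t => J k (fun t => H (-t) (A (-t)) (B (-t))) (-t) := by
    funext t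
    exact tendsto_nhds_unique ((tendsto_add_atTop_iff_nat 1).2 (hB t))
      (J_tendsto hk (fun n => (ad n).neg) (fun t => lim (-t)) (-t))
  have cA : Continuous A := by rw [eA]; exact J_cont hk adm
  have cB : Continuous B := by rw [eB]; exact (J_cont hk adm.neg).comp continuous_neg
  refine ⟨A, B, bA, bB, ?_, ?_, ?_, ?_⟩
  · intro t
    refine tendsto_nhds_unique (hA (t + T)) ?_
    simp only [(main _).2.2.2.1]; exact hA t
  · intro t
    refine tendsto_nhds_unique (hB (t + T)) ?_
    simp only [(main _).2.2.2.2]; exact hB t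
  · intro t
    have := J_deriv hk adm (Hcomp A B cA cB) t
    rwa [← eA] at this
  · intro t
    have h1 := J_deriv hk adm.neg ((Hcomp A B cA cB).comp continuous_neg) (-t)
    have h2 := h1.comp t (hasDerivAt_neg t)
    have e := congrFun eB t
    rw [← e] at h2
    have e2 : (J k (fun t => H (-t) (A (-t)) (B (-t))) ∘ Neg.neg) = B := eB.symm
    rw [e2] at h2
    refine h2.congr_deriv ?_
    simp only [neg_neg]; ring

theorem per_bound {T R : ℝ} (hT : 0 < T) (p p' : ℝ → ℝ) (hp : ∀ t, HasDerivAt p (p' t) t)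
    (per : ∀ t, p (t + T) = p t) (h : ∀ t, p' t = 0 → p t ≤ R) (t : ℝ) : p t ≤ R := by
  have hc : Continuous p := continuous_iff_continuousAt.2 fun t => (hp t).continuousAt
  obtain ⟨x, hx, hmax⟩ := isCompact_Icc.exists_isMaxOn (nonempty_Icc.2 hT.le) hc.continuousOn
  have hall : ∀ y, p y ≤ p x := by
    intro y
    obtain ⟨z, hz, e⟩ := Function.Periodic.exists_mem_Ico₀ (f := p) (c := T) per hT y
    rw [e]; exact hmax (Ico_subset_Icc_self hz)
  have : p' x = 0 := IsLocalMax.hasDerivAt_eq_zero (Eventually.of_forall hall) (hp x)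
  exact (hall t).trans (h x this)

end Pend

/-- For any bounded control `u` (continuous, locally Lipschitz in `(q,p)`, `T`-periodic in `t`)
and any friction coefficient `ν > 0`, the damped system
`q̇ = p, ṗ = u(q,p,t)·sin q − cos q − ν p` has an initial condition `(q₀,p₀)` with
`0 < q₀ < π` whose solution is defined for all `t`, is `T`-periodic, and satisfies
`0 < q(t) < π` for all `t`. -/
theorem inverted_pendulum_friction_periodic_never_falling_solution
    (u : ℝ → ℝ → ℝ → ℝ)
    (hu_cont : Continuous fun x : ℝ × ℝ × ℝ => u x.1 x.2.1 x.2.2)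
    (hu_lip : ∀ K : Set (ℝ × ℝ × ℝ), IsCompact K → ∃ L : ℝ,
      ∀ a ∈ K, ∀ b ∈ K, a.2.2 = b.2.2 →
        |u a.1 a.2.1 a.2.2 - u b.1 b.2.1 b.2.2| ≤
          L * dist ((a.1, a.2.1) : ℝ × ℝ) ((b.1, b.2.1) : ℝ × ℝ))
    (hu_bdd : ∃ C : ℝ, ∀ q p t : ℝ, |u q p t| ≤ C)
    (T : ℝ) (hT : 0 < T)
    (hu_per : ∀ q p t : ℝ, u q p (t + T) = u q p t)
    (ν : ℝ) (hν : 0 < ν) :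
    ∃ q₀ p₀ : ℝ, 0 < q₀ ∧ q₀ < π ∧
      ∃ q p : ℝ → ℝ,
        q 0 = q₀ ∧ p 0 = p₀ ∧
        (∀ t : ℝ, HasDerivAt q (p t) t) ∧
        (∀ t : ℝ, HasDerivAt p
          (u (q t) (p t) t * sin (q t) - cos (q t) - ν * p t) t) ∧
        (∀ t : ℝ, q (t + T) = q t ∧ p (t + T) = p t) ∧
        (∀ t : ℝ, 0 < q t ∧ q t < π) := by
  obtain ⟨C, hC⟩ := hu_bdd
  have hC0 : 0 ≤ C := (abs_nonneg _).trans (hC 0 0 0)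
  have hpi := Real.pi_pos
  set R : ℝ := (C + 1) / ν with hR
  have hR0 : 0 < R := by positivity
  have hνR : ν * R = C + 1 := by rw [hR]; field_simp
  obtain ⟨L₀, hL₀⟩ := hu_lip (Icc 0 π ×ˢ Icc (-R) R ×ˢ Icc 0 T)
    (isCompact_Icc.prod (isCompact_Icc.prod isCompact_Icc))
  -- truncation
  let c1 : ℝ → ℝ := fun q => max 0 (min π q)
  let c2 : ℝ → ℝ := fun p => max (-R) (min R p)
  have c1m : ∀ q, c1 q ∈ Icc 0 π := fun q => ⟨le_max_left _ _, max_le hpi.le (min_le_left _ _)⟩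
  have c2m : ∀ q, c2 q ∈ Icc (-R) R :=
    fun q => ⟨le_max_left _ _, max_le (by linarith) (min_le_left _ _)⟩
  have c1e : ∀ q, 0 ≤ q → q ≤ π → c1 q = q := fun q h1 h2 => by
    simp only [c1]; rw [min_eq_right h2, max_eq_right h1]
  have c2e : ∀ q, -R ≤ q → q ≤ R → c2 q = q := fun q h1 h2 => by
    simp only [c2]; rw [min_eq_right h2, max_eq_right h1]
  have c1l : ∀ x y, |c1 x - c1 y| ≤ |x - y| := fun x y => by
    refine (abs_max_sub_max_le_max 0 (min π x) 0 (min π y)).trans (max_le (by simp) ?_)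
    exact (abs_min_sub_min_le_max π x π y).trans (max_le (by simp) le_rfl)
  have c2l : ∀ x y, |c2 x - c2 y| ≤ |x - y| := fun x y => by
    refine (abs_max_sub_max_le_max (-R) (min R x) (-R) (min R y)).trans (max_le (by simp) ?_)
    exact (abs_min_sub_min_le_max R x R y).trans (max_le (by simp) le_rfl)
  set L : ℝ := |L₀| with hL
  have hL0 : 0 ≤ L := abs_nonneg _
  have ulip : ∀ q p q' p' t, |u (c1 q) (c2 p) t - u (c1 q') (c2 p') t| ≤
      L * (|q - q'| + |p - p'|) := by
    intro q p q' p' t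
    obtain ⟨s, hs, e⟩ := Function.Periodic.exists_mem_Ico₀
      (f := fun t => (u (c1 q) (c2 p) t, u (c1 q') (c2 p') t)) (c := T)
      (fun t => by simp only [hu_per]) hT t
    have e1 := congrArg Prod.fst e
    have e2 := congrArg Prod.snd e
    simp only at e1 e2
    rw [e1, e2]
    have := hL₀ (c1 q, c2 p, s) ⟨c1m _, c2m _, Ico_subset_Icc_self hs⟩
      (c1 q', c2 p', s) ⟨c1m _, c2m _, Ico_subset_Icc_self hs⟩ rfl
    refine this.trans ?_
    refine mul_le_mul (le_abs_self _) ?_ dist_nonneg hL0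
    rw [Prod.dist_eq, Real.dist_eq, Real.dist_eq]
    refine max_le ((c1l q q').trans ?_) ((c2l p p').trans ?_)
    · linarith [abs_nonneg (p - p')]
    · linarith [abs_nonneg (q - q')]
  let F : ℝ → ℝ → ℝ → ℝ := fun t q p => u (c1 q) (c2 p) t * sin q - cos q - ν * p
  set M : ℝ := L + C + 1 + ν with hM
  have hM0 : 0 < M := by positivity
  have Flip : ∀ t q p q' p', |F t q p - F t q' p'| ≤ M * (|q - q'| + |p - p'|) := by
    intro t q p q' p'
    have h1 : |(u (c1 q) (c2 p) t - u (c1 q') (c2 p') t) * sin q| ≤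
        L * (|q - q'| + |p - p'|) := by
      rw [abs_mul]
      calc _ ≤ |u (c1 q) (c2 p) t - u (c1 q') (c2 p') t| * 1 :=
            mul_le_mul_of_nonneg_left (abs_sin_le_one q) (abs_nonneg _)
        _ ≤ _ := by rw [mul_one]; exact ulip q p q' p' t
    have h2 : |u (c1 q') (c2 p') t * (sin q - sin q')| ≤ C * |q - q'| := by
      rw [abs_mul]
      exact mul_le_mul (hC _ _ _) (Real.abs_sin_sub_sin_le q q') (abs_nonneg _) hC0
    have h3 : |cos q - cos q'| ≤ |q - q'| := Real.abs_cos_sub_cos_le q q'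
    have h4 : |ν * (p - p')| = ν * |p - p'| := by rw [abs_mul, abs_of_pos hν]
    have e : F t q p - F t q' p' = (u (c1 q) (c2 p) t - u (c1 q') (c2 p') t) * sin q
        + u (c1 q') (c2 p') t * (sin q - sin q') - (cos q - cos q') - ν * (p - p') := by
      simp only [F]; ring
    rw [e]
    have a1 := abs_nonneg (q - q')
    have a2 := abs_nonneg (p - p')
    have b1 := mul_nonneg hC0 a2
    have b2 := mul_nonneg hν.le a1
    have g1 := abs_le.1 h1
    have g2 := abs_le.1 h2
    have g3 := abs_le.1 h3
    have g4 := abs_le.1 h4.le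
    rw [abs_le]
    constructor <;> rw [hM] <;> nlinarith
  set k : ℝ := M + 1 with hk
  have hk0 : 0 < k := by positivity
  let H : ℝ → ℝ → ℝ → ℝ := fun t a b =>
    k * (a + b) / 2 - F t ((a + b) / (2 * k)) ((b - a) / 2)
  have uc : ∀ f g h : ℝ × ℝ × ℝ → ℝ, Continuous f → Continuous g → Continuous h →
      Continuous fun x => u (f x) (g x) (h x) := fun f g h hf hg hh =>
    hu_cont.comp (hf.prodMk (hg.prodMk hh))
  have Hc : Continuous fun x : ℝ × ℝ × ℝ => H x.1 x.2.1 x.2.2 := by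
    simp only [H, F, c1, c2]
    have := uc (fun x => max 0 (min π ((x.2.1 + x.2.2) / (2 * k))))
      (fun x => max (-R) (min R ((x.2.2 - x.2.1) / 2))) (fun x => x.1)
      (by fun_prop) (by fun_prop) (by fun_prop)
    fun_prop
  have Hm : ∀ t a b a' b', a ≤ a' → b ≤ b' → H t a b ≤ H t a' b' := by
    intro t a b a' b' ha hb
    have h := (abs_le.1 (Flip t ((a' + b') / (2 * k)) ((b' - a') / 2)
      ((a + b) / (2 * k)) ((b - a) / 2))).2
    set d := (a' - a + (b' - b)) / (2 * k) with hd
    have hd0 : 0 ≤ d := by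
      apply div_nonneg <;> linarith
    have hkd : k * d = (a' - a + (b' - b)) / 2 := by rw [hd]; field_simp
    have e1 : (a' + b') / (2 * k) - (a + b) / (2 * k) = d := by rw [hd]; ring
    have e2 : |(b' - a') / 2 - (b - a) / 2| ≤ k * d := by
      rw [hkd, abs_le]; constructor <;> linarith
    rw [e1, abs_of_nonneg hd0] at h
    have h5 : M * (d + |(b' - a') / 2 - (b - a) / 2|) ≤ M * (d + k * d) :=
      mul_le_mul_of_nonneg_left (by linarith) hM0.le
    have h6 : k * (k * d) = M * (d + k * d) + d := by rw [hk]; ring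
    have h7 : k * (a' + b') / 2 - k * (a + b) / 2 = k * (k * d) := by rw [hkd]; ring
    simp only [H]
    linarith
  have H0 : ∀ t, H t 0 0 = 1 := by intro t; simp [H, F]
  have eN : (k * π + k * π) / (2 * k) = π := by field_simp; ring
  have H1 : ∀ t, H t (k * π) (k * π) = k * (k * π) - 1 := by
    intro t; simp only [H, F, eN]; simp; ring
  obtain ⟨A, B, bA, bB, pA, pB, dA, dB⟩ := Pend.exists_AB k (k * π) T hk0 (by positivity) H Hc Hm
    (fun t a b => by simp only [H, F, hu_per]) (fun t => by rw [H0]; norm_num)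
    (fun t => by rw [H1]; linarith)
  let q : ℝ → ℝ := fun t => (A t + B t) / (2 * k)
  let p : ℝ → ℝ := fun t => (B t - A t) / 2
  have dq : ∀ t, HasDerivAt q (p t) t := by
    intro t
    refine (((dA t).add (dB t)).div_const (2 * k)).congr_deriv ?_
    simp only [p]; field_simp; ring
  have dp : ∀ t, HasDerivAt p (F t (q t) (p t)) t := by
    intro t
    refine (((dB t).sub (dA t)).div_const 2).congr_deriv ?_
    simp only [p, q, H]; ring
  have pq : ∀ t, q (t + T) = q t := fun t => by simp only [q, pA, pB]
  have pp : ∀ t, p (t + T) = p t := fun t => by simp only [p, pA, pB]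
  have hq : ∀ t, 0 < q t ∧ q t < π := by
    intro t
    constructor
    · apply div_pos _ (by positivity)
      by_contra hcon
      have a0 : A t = 0 := by linarith [(bA t).1, (bB t).1]
      have b0 : B t = 0 := by linarith [(bA t).1, (bB t).1]
      have : H t (A t) (B t) - k * A t = 0 := IsLocalMin.hasDerivAt_eq_zero
        (Filter.Eventually.of_forall fun s => by rw [a0]; exact (bA s).1) (dA t)
      rw [a0, b0, H0] at this
      norm_num at this
    · simp only [q]
      rw [div_lt_iff₀ (by positivity)]
      by_contra hcon
      have a0 : A t = k * π := by linarith [(bA t).2, (bB t).2]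
      have b0 : B t = k * π := by linarith [(bA t).2, (bB t).2]
      have : H t (A t) (B t) - k * A t = 0 := IsLocalMax.hasDerivAt_eq_zero
        (Filter.Eventually.of_forall fun s => by rw [a0]; exact (bA s).2) (dA t)
      rw [a0, b0, H1] at this
      linarith
  have key : ∀ t, |u (c1 (q t)) (c2 (p t)) t * sin (q t) - cos (q t)| ≤ C + 1 := by
    intro t
    refine (abs_sub _ _).trans (add_le_add ?_ (abs_cos_le_one _))
    rw [abs_mul]
    calc _ ≤ C * 1 := mul_le_mul (hC _ _ _) (abs_sin_le_one _) (abs_nonneg _) hC0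
      _ = C := mul_one C
  have pR : ∀ t, p t ≤ R := Pend.per_bound hT p _ dp pp (fun t h => by
    have := (abs_le.1 (key t)).2
    simp only [F] at h
    by_contra hcon
    have := mul_lt_mul_of_pos_left (not_le.1 hcon) hν
    linarith)
  have pR' : ∀ t, -p t ≤ R := Pend.per_bound hT (fun t => -p t) _ (fun t => (dp t).neg)
    (fun t => by simp only [pp]) (fun t h => by
    have := (abs_le.1 (key t)).1
    simp only [F] at h
    by_contra hcon
    have := mul_lt_mul_of_pos_left (not_le.1 hcon) hν
    linarith)
  refine ⟨q 0, p 0, (hq 0).1, (hq 0).2, q, p, rfl, rfl, dq, ?_, fun t => ⟨pq t, pp t⟩, hq⟩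
  intro t
  have := dp t
  simp only [F] at this
  rwa [c1e _ (hq t).1.le (hq t).2.le, c2e _ (by linarith [pR' t]) (pR t)] at this
end

section
/- Let u : ℝ³ → ℝ be any control function continuous in all variables and locally Lipschitz in (q,p), and let q* ∈ ℝ satisfy q* < 0 or q* > π (a position of the rod below the horizon). Then for any t₀ ∈ ℝ there exists an initial condition (q₀, p₀) with 0 < q₀ < π such that every solution (q(t), p(t)) of the system q̇ = p, ṗ = u(q,p,t)·sin q − cos q with (q(t₀), p(t₀)) = (q₀, p₀) satisfies |q(t) − q*| ≥ dist(q*, [0, π]) > 0 for all t ≥ t₀ in its interval of existence; in particular, no Lipschitz control u can globally stabilize the pendulum at a position below the horizon. -/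
open Real Set

namespace PendAux

/-- The vector field of the system on the phase plane. -/
noncomputable def fld (u : ℝ → ℝ → ℝ → ℝ) (t : ℝ) (x : ℝ × ℝ) : ℝ × ℝ :=
  (x.2, u x.1 x.2 t * sin x.1 - cos x.1)

/-- Solutions on `[a, T]` starting at `x`. -/
def Sol (u : ℝ → ℝ → ℝ → ℝ) (a : ℝ) (x : ℝ × ℝ) (T : ℝ) (f : ℝ → ℝ × ℝ) : Prop :=
  f a = x ∧ ∀ t ∈ Icc a T, HasDerivWithinAt f (fld u t (f t)) (Icc a T) t

/-- Local Lipschitz hypothesis. -/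
def Lip (u : ℝ → ℝ → ℝ → ℝ) : Prop :=
  ∀ K : Set (ℝ × ℝ × ℝ), IsCompact K → ∃ L : ℝ,
      ∀ a ∈ K, ∀ b ∈ K, a.2.2 = b.2.2 →
        |u a.1 a.2.1 a.2.2 - u b.1 b.2.1 b.2.2| ≤
          L * dist ((a.1, a.2.1) : ℝ × ℝ) ((b.1, b.2.1) : ℝ × ℝ)

/-- Clamping a real number. -/
noncomputable def clamp (R : ℝ) (s : ℝ) : ℝ := max (-R) (min R s)

/-- Clamping a point of the plane. -/
noncomputable def clamp2 (R : ℝ) (x : ℝ × ℝ) : ℝ × ℝ := (clamp R x.1, clamp R x.2)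

lemma clamp_eq {R s : ℝ} (h : |s| ≤ R) : clamp R s = s := by
  rw [abs_le] at h
  simp [clamp, h.1, h.2]

lemma clamp_abs {R s : ℝ} (h : 0 ≤ R) : |clamp R s| ≤ R := by
  rw [abs_le]
  unfold clamp
  exact ⟨le_max_left _ _, max_le (by linarith) (min_le_left _ _)⟩

lemma clamp_dist (R s s' : ℝ) : |clamp R s - clamp R s'| ≤ |s - s'| := by
  unfold clamp
  calc _ ≤ |min R s - min R s'| := by
        simpa using abs_max_sub_max_le_max (-R) (min R s) (-R) (min R s')
    _ ≤ _ := by simpa using abs_min_sub_min_le_max R s R s'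

lemma clamp2_eq {R : ℝ} {x : ℝ × ℝ} (h : ‖x‖ ≤ R) : clamp2 R x = x := by
  have h1 : |x.1| ≤ R := (norm_fst_le x).trans h
  have h2 : |x.2| ≤ R := (norm_snd_le x).trans h
  simp [clamp2, clamp_eq h1, clamp_eq h2]

lemma clamp2_norm {R : ℝ} (x : ℝ × ℝ) (h : 0 ≤ R) : ‖clamp2 R x‖ ≤ R := by
  rw [Prod.norm_def]
  exact max_le (clamp_abs h) (clamp_abs h)

lemma clamp2_lip (R : ℝ) : LipschitzWith 1 (clamp2 R) := by
  apply LipschitzWith.of_dist_le_mul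
  intro x y
  rw [NNReal.coe_one, one_mul, Prod.dist_eq, Prod.dist_eq]
  exact max_le_max (clamp_dist R _ _) (clamp_dist R _ _)

lemma fld_cont {u : ℝ → ℝ → ℝ → ℝ}
    (hu : Continuous fun x : ℝ × ℝ × ℝ => u x.1 x.2.1 x.2.2) :
    Continuous fun y : ℝ × (ℝ × ℝ) => fld u y.1 y.2 := by
  have h : Continuous fun y : ℝ × (ℝ × ℝ) => u y.2.1 y.2.2 y.1 :=
    hu.comp (by fun_prop : Continuous fun y : ℝ × (ℝ × ℝ) => ((y.2.1, y.2.2, y.1) : ℝ × ℝ × ℝ))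
  unfold fld
  fun_prop

lemma fld_lip {u : ℝ → ℝ → ℝ → ℝ}
    (hu : Continuous fun x : ℝ × ℝ × ℝ => u x.1 x.2.1 x.2.2) (hl : Lip u) (a T R : ℝ) :
    ∃ K : NNReal, ∀ t ∈ Icc a T, LipschitzOnWith K (fld u t) (Metric.closedBall 0 R) := by
  set C : Set (ℝ × ℝ × ℝ) := Icc (-R) R ×ˢ Icc (-R) R ×ˢ Icc a T with hC
  have hCc : IsCompact C := isCompact_Icc.prod (isCompact_Icc.prod isCompact_Icc)
  obtain ⟨L, hL⟩ := hl C hCc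
  obtain ⟨M, hM⟩ := hCc.exists_bound_of_continuousOn hu.continuousOn
  refine ⟨Real.toNNReal (1 + |L| + |M|), fun t ht => LipschitzOnWith.of_dist_le_mul ?_⟩
  intro x hx y hy
  rw [Real.coe_toNNReal _ (by positivity)]
  have mem : ∀ x ∈ Metric.closedBall (0 : ℝ × ℝ) R, (x.1, x.2, t) ∈ C := by
    intro x hx
    rw [mem_closedBall_zero_iff] at hx
    have h1 : |x.1| ≤ R := (norm_fst_le x).trans hx
    have h2 : |x.2| ≤ R := (norm_snd_le x).trans hx
    exact ⟨abs_le.1 h1, abs_le.1 h2, ht⟩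
  have h1 := hL _ (mem x hx) _ (mem y hy) rfl
  have h2 := hM _ (mem y hy)
  simp only [Real.norm_eq_abs] at h2
  simp only [Prod.mk.eta] at h1
  have hd : 0 ≤ dist x y := dist_nonneg
  have hd1 : |x.1 - y.1| ≤ dist x y := by
    rw [Prod.dist_eq]; exact le_max_left _ _
  have hd2 : |x.2 - y.2| ≤ dist x y := by
    rw [Prod.dist_eq]; exact le_max_right _ _
  have hs : |sin x.1 - sin y.1| ≤ dist x y := (Real.abs_sin_sub_sin_le _ _).trans hd1
  have hc : |cos x.1 - cos y.1| ≤ dist x y := (Real.abs_cos_sub_cos_le _ _).trans hd1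
  have hLd : L * dist x y ≤ |L| * dist x y := by gcongr; exact le_abs_self L
  have hMd : |u y.1 y.2 t| ≤ |M| := h2.trans (le_abs_self M)
  rw [Prod.dist_eq (x := fld u t x)]
  apply max_le
  · change |x.2 - y.2| ≤ _
    nlinarith [abs_nonneg L, abs_nonneg M, mul_nonneg (abs_nonneg L) hd, mul_nonneg (abs_nonneg M) hd]
  · change |(u x.1 x.2 t * sin x.1 - cos x.1) - (u y.1 y.2 t * sin y.1 - cos y.1)| ≤ _
    have e : (u x.1 x.2 t * sin x.1 - cos x.1) - (u y.1 y.2 t * sin y.1 - cos y.1)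
      = (u x.1 x.2 t - u y.1 y.2 t) * sin x.1 + u y.1 y.2 t * (sin x.1 - sin y.1)
        + -(cos x.1 - cos y.1) := by ring
    rw [e]
    refine (abs_add_three _ _ _).trans ?_
    rw [abs_mul, abs_mul, abs_neg]
    have t1 : |u x.1 x.2 t - u y.1 y.2 t| * |sin x.1| ≤ |L| * dist x y := by
      calc _ ≤ |u x.1 x.2 t - u y.1 y.2 t| * 1 := by gcongr; exact Real.abs_sin_le_one _
        _ ≤ _ := by rw [mul_one]; exact h1.trans hLd
    have t2 : |u y.1 y.2 t| * |sin x.1 - sin y.1| ≤ |M| * dist x y := by gcongr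
    nlinarith

/-- Global existence and continuous dependence for the truncated field. -/
lemma trunc_exists {u : ℝ → ℝ → ℝ → ℝ}
    (hu : Continuous fun x : ℝ × ℝ × ℝ => u x.1 x.2.1 x.2.2) (hl : Lip u) {a T R : ℝ}
    (hT : a ≤ T) (hR : 0 ≤ R) (x : ℝ × ℝ) :
    ∃ f : ℝ → ℝ × ℝ, f a = x ∧
      ∀ t ∈ Icc a T, HasDerivWithinAt f (fld u t (clamp2 R (f t))) (Icc a T) t := by
  obtain ⟨K, hK⟩ := fld_lip hu hl a T R
  have hcomp : IsCompact (Icc a T ×ˢ Metric.closedBall (0 : ℝ × ℝ) R) :=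
    isCompact_Icc.prod (isCompact_closedBall _ _)
  obtain ⟨M, hM⟩ := hcomp.exists_bound_of_continuousOn (fld_cont hu).continuousOn
  have hcl : ∀ y, clamp2 R y ∈ Metric.closedBall (0 : ℝ × ℝ) R := fun y => by
    rw [mem_closedBall_zero_iff]; exact clamp2_norm y hR
  have hPL : IsPicardLindelof (fun t y => fld u t (clamp2 R y)) (tmin := a) (tmax := T)
      ⟨a, left_mem_Icc.2 hT⟩ x (Real.toNNReal |M| * Real.toNNReal (T - a)) 0
      (Real.toNNReal |M|) K := by
    constructor
    · intro t ht
      have := (hK t ht).comp ((clamp2_lip R).lipschitzOnWith (s := Metric.closedBall x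
        (Real.toNNReal |M| * Real.toNNReal (T - a) : NNReal))) (fun y _ => hcl y)
      rw [mul_one] at this
      exact this
    · intro y _
      exact ((fld_cont hu).comp (by fun_prop : Continuous fun t : ℝ => (t, clamp2 R y))).continuousOn
    · intro t ht y _
      rw [Real.coe_toNNReal _ (abs_nonneg _)]
      exact (hM (t, clamp2 R y) ⟨ht, hcl y⟩).trans (le_abs_self M)
    · simp [hT]
  obtain ⟨f, hf, hf'⟩ := hPL.exists_eq_forall_mem_Icc_hasDerivWithinAt₀
  exact ⟨f, hf, hf'⟩

lemma to_Ici {f : ℝ → ℝ × ℝ} {f' : ℝ × ℝ} {a T t : ℝ} (ht : t ∈ Ico a T)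
    (h : HasDerivWithinAt f f' (Icc a T) t) : HasDerivWithinAt f f' (Ici t) t := by
  apply h.mono_of_mem_nhdsWithin
  exact Filter.mem_of_superset (Icc_mem_nhdsGE ht.2) (Icc_subset_Icc_left ht.1)

lemma Sol.cont {u : ℝ → ℝ → ℝ → ℝ} {a T : ℝ} {x : ℝ × ℝ} {f : ℝ → ℝ × ℝ}
    (h : Sol u a x T f) : ContinuousOn f (Icc a T) :=
  fun t ht => (h.2 t ht).continuousWithinAt

lemma Sol.mono {u : ℝ → ℝ → ℝ → ℝ} {a T T' : ℝ} {x : ℝ × ℝ} {f : ℝ → ℝ × ℝ}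
    (h : Sol u a x T f) (hT : T' ≤ T) : Sol u a x T' f :=
  ⟨h.1, fun t ht => (h.2 t ⟨ht.1, ht.2.trans hT⟩).mono (Icc_subset_Icc_right hT)⟩

lemma Sol.fst {u : ℝ → ℝ → ℝ → ℝ} {a T : ℝ} {x : ℝ × ℝ} {f : ℝ → ℝ × ℝ}
    (h : Sol u a x T f) {t : ℝ} (ht : t ∈ Icc a T) :
    HasDerivWithinAt (fun t => (f t).1) (f t).2 (Icc a T) t := by
  have := (h.2 t ht).hasFDerivWithinAt.fst.hasDerivWithinAt
  simpa [fld] using this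

lemma Sol.snd {u : ℝ → ℝ → ℝ → ℝ} {a T : ℝ} {x : ℝ × ℝ} {f : ℝ → ℝ × ℝ}
    (h : Sol u a x T f) {t : ℝ} (ht : t ∈ Icc a T) :
    HasDerivWithinAt (fun t => (f t).2) (u (f t).1 (f t).2 t * sin (f t).1 - cos (f t).1)
      (Icc a T) t := by
  have := (h.2 t ht).hasFDerivWithinAt.snd.hasDerivWithinAt
  simpa [fld] using this

lemma Sol.bdd {u : ℝ → ℝ → ℝ → ℝ} {a T : ℝ} {x : ℝ × ℝ} {f : ℝ → ℝ × ℝ}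
    (h : Sol u a x T f) : ∃ R, 0 ≤ R ∧ ∀ t ∈ Icc a T, ‖f t‖ ≤ R := by
  obtain ⟨R, hR⟩ := isCompact_Icc.exists_bound_of_continuousOn h.cont
  exact ⟨|R|, abs_nonneg _, fun t ht => (hR t ht).trans (le_abs_self R)⟩

lemma Sol.unique {u : ℝ → ℝ → ℝ → ℝ}
    (hu : Continuous fun x : ℝ × ℝ × ℝ => u x.1 x.2.1 x.2.2) (hl : Lip u) {a T : ℝ}
    {x : ℝ × ℝ} {f g : ℝ → ℝ × ℝ} (hf : Sol u a x T f) (hg : Sol u a x T g) :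
    EqOn f g (Icc a T) := by
  obtain ⟨R, hR0, hR⟩ := hf.bdd
  obtain ⟨R', hR0', hR'⟩ := hg.bdd
  obtain ⟨K, hK⟩ := fld_lip hu hl a T (max R R')
  refine ODE_solution_unique_of_mem_Icc_right (v := fld u)
    (s := fun _ => Metric.closedBall 0 (max R R')) (K := K)
    (fun t ht => hK t (Ico_subset_Icc_self ht)) hf.cont
    (fun t ht => to_Ici ht (hf.2 t (Ico_subset_Icc_self ht))) ?_ hg.cont
    (fun t ht => to_Ici ht (hg.2 t (Ico_subset_Icc_self ht))) ?_ (hf.1.trans hg.1.symm)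
  · intro t ht
    rw [mem_closedBall_zero_iff]
    exact (hR t (Ico_subset_Icc_self ht)).trans (le_max_left _ _)
  · intro t ht
    rw [mem_closedBall_zero_iff]
    exact (hR' t (Ico_subset_Icc_self ht)).trans (le_max_right _ _)

lemma Sol.nearby {u : ℝ → ℝ → ℝ → ℝ}
    (hu : Continuous fun x : ℝ × ℝ × ℝ => u x.1 x.2.1 x.2.2) (hl : Lip u) {a T : ℝ}
    (hT : a ≤ T) {x : ℝ × ℝ} {f : ℝ → ℝ × ℝ} (hf : Sol u a x T f) {ε : ℝ} (hε : 0 < ε) :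
    ∃ δ > 0, ∀ y, dist y x < δ → ∃ g, Sol u a y T g ∧ ∀ t ∈ Icc a T, dist (g t) (f t) < ε := by
  obtain ⟨R, hR0, hR⟩ := hf.bdd
  have hR1 : 0 ≤ R + 1 := by linarith
  obtain ⟨K, hK⟩ := fld_lip hu hl a T (R + 1)
  set E := exp (K * (T - a)) with hE
  have hEpos : 0 < E := exp_pos _
  have hmin : 0 < min ε 1 := lt_min hε one_pos
  refine ⟨min ε 1 / E, by positivity, fun y hy => ?_⟩
  obtain ⟨g, hga, hg⟩ := trunc_exists hu hl hT hR1 y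
  have hf' : ∀ t ∈ Icc a T, HasDerivWithinAt f (fld u t (clamp2 (R + 1) (f t))) (Icc a T) t := by
    intro t ht
    rw [clamp2_eq ((hR t ht).trans (by linarith))]
    exact hf.2 t ht
  have hlip : ∀ t ∈ Ico a T, LipschitzOnWith K (fun y => fld u t (clamp2 (R + 1) y)) univ := by
    intro t ht
    have := (hK t (Ico_subset_Icc_self ht)).comp
      ((clamp2_lip (R + 1)).lipschitzOnWith (s := univ)) (fun y _ => by
        rw [mem_closedBall_zero_iff]; exact clamp2_norm y hR1)
    rw [mul_one] at this
    exact this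
  have key := dist_le_of_trajectories_ODE_of_mem (δ := dist y x) hlip
    (fun t ht => (hg t ht).continuousWithinAt)
    (fun t ht => to_Ici ht (hg t (Ico_subset_Icc_self ht))) (fun _ _ => trivial)
    hf.cont (fun t ht => to_Ici ht (hf' t (Ico_subset_Icc_self ht))) (fun _ _ => trivial)
    (by rw [hga, hf.1])
  have key2 : ∀ t ∈ Icc a T, dist (g t) (f t) < min ε 1 := by
    intro t ht
    calc _ ≤ dist y x * exp (K * (t - a)) := key t ht
      _ ≤ dist y x * E := by
        rw [hE]; gcongr; exact ht.2
      _ < min ε 1 / E * E := by gcongr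
      _ = min ε 1 := by field_simp
  refine ⟨g, ⟨hga, fun t ht => ?_⟩, fun t ht => (key2 t ht).trans_le (min_le_left _ _)⟩
  have : ‖g t‖ ≤ R + 1 := by
    have h1 := (key2 t ht).le.trans (min_le_right _ _)
    have h2 := hR t ht
    rw [dist_eq_norm] at h1
    calc ‖g t‖ = ‖f t + (g t - f t)‖ := by congr 1; abel
      _ ≤ ‖f t‖ + ‖g t - f t‖ := norm_add_le _ _
      _ ≤ _ := by linarith
  have h := hg t ht
  rwa [clamp2_eq this] at h

lemma local_exists {u : ℝ → ℝ → ℝ → ℝ}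
    (hu : Continuous fun x : ℝ × ℝ × ℝ => u x.1 x.2.1 x.2.2) (hl : Lip u) (a : ℝ)
    (x : ℝ × ℝ) : ∃ T > a, ∃ f, Sol u a x T f := by
  have hR : 0 ≤ ‖x‖ + 1 := by positivity
  obtain ⟨f, hfa, hf⟩ := trunc_exists hu hl (by linarith : a ≤ a + 1) hR x
  have ha : a ∈ Icc a (a + 1) := ⟨le_rfl, by linarith⟩
  have hc : ContinuousWithinAt (fun t => ‖f t‖) (Icc a (a + 1)) a :=
    (hf a ha).continuousWithinAt.norm
  have hev : ∀ᶠ t in nhdsWithin a (Icc a (a + 1)), ‖f t‖ < ‖x‖ + 1 := by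
    apply hc.eventually_lt_const
    simp [hfa]
  obtain ⟨ε, hε, h⟩ := Metric.mem_nhdsWithin_iff.1 hev
  have hm : 0 < min (ε / 2) 1 := lt_min (by linarith) one_pos
  refine ⟨a + min (ε / 2) 1, by linarith, f, hfa, fun t ht => ?_⟩
  have hsub : Icc a (a + min (ε / 2) 1) ⊆ Icc a (a + 1) :=
    Icc_subset_Icc_right (by linarith [min_le_right (ε / 2) 1])
  have hb : ‖f t‖ < ‖x‖ + 1 := by
    refine h ⟨?_, hsub ht⟩
    rw [Metric.mem_ball, Real.dist_eq, abs_of_nonneg (by linarith [ht.1])]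
    linarith [ht.2, min_le_left (ε / 2) 1]
  have h1 := (hf t (hsub ht)).mono hsub
  rwa [clamp2_eq hb.le] at h1

/-- Immediately after a crossing with negative speed, the function is negative. -/
lemma after_cross {q : ℝ → ℝ} {a b c m : ℝ} (hac : a ≤ c) (hcb : c < b)
    (hq : HasDerivWithinAt q m (Icc a b) c) (hm : m < 0) (h0 : q c = 0) :
    ∃ T, c < T ∧ T ≤ b ∧ ∀ t ∈ Ioc c T, q t < 0 := by
  have h1 : HasDerivWithinAt q m (Ioi c) c := by
    apply hq.mono_of_mem_nhdsWithin
    exact Filter.mem_of_superset (Ioc_mem_nhdsGT hcb) (fun t ht => ⟨hac.trans ht.1.le, ht.2⟩)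
  have h2 := h1.limsup_slope_le' (by simp) hm
  obtain ⟨d, hd, hsub⟩ := (mem_nhdsGT_iff_exists_Ioo_subset).1 h2
  rw [mem_Ioi] at hd
  refine ⟨min ((c + d) / 2) b, lt_min (by linarith) hcb, min_le_right _ _, fun t ht => ?_⟩
  have hm := min_le_left ((c + d) / 2) b
  have h3 : slope q c t < 0 := hsub ⟨ht.1, by linarith [ht.2]⟩
  rw [slope_def_field, h0, sub_zero, div_neg_iff] at h3
  rcases h3 with h3 | h3
  · linarith [h3.2, ht.1]
  · exact h3.1

/-- At the first zero of `q` with acceleration `-1`, the speed is negative. -/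
lemma speed_neg {q p : ℝ → ℝ} {a b c : ℝ} (hac : a < c) (hcb : c ≤ b)
    (hq : ∀ t ∈ Icc a b, HasDerivWithinAt q (p t) (Icc a b) t)
    (hp : HasDerivWithinAt p (-1) (Icc a b) c) (hpos : ∀ t ∈ Ico a c, 0 < q t)
    (h0 : q c = 0) : p c < 0 := by
  by_contra hneg
  push Not at hneg
  have h1 : HasDerivWithinAt p (-1) (Iio c) c := by
    apply hp.mono_of_mem_nhdsWithin
    exact Filter.mem_of_superset (Ico_mem_nhdsLT hac) (fun t ht => ⟨ht.1, ht.2.le.trans hcb⟩)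
  have h2 := h1.limsup_slope_le' (by simp) (by norm_num : (-1 : ℝ) < 0)
  obtain ⟨d, hd, hsub⟩ := (mem_nhdsLT_iff_exists_Ioo_subset).1 h2
  rw [mem_Iio] at hd
  have hp' : ∀ t ∈ Ioo d c, 0 < p t := by
    intro t ht
    have h3 : slope p c t < 0 := hsub ht
    rw [slope_def_field, div_neg_iff] at h3
    rcases h3 with h3 | h3
    · linarith [h3.1]
    · linarith [h3.2, ht.2]
  set e := max d a with he
  have hec : e < c := max_lt hd hac
  have hea : a ≤ e := le_max_right _ _
  have hsub2 : Icc e c ⊆ Icc a b := Icc_subset_Icc hea hcb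
  have hmono : StrictMonoOn q (Icc e c) := by
    apply strictMonoOn_of_hasDerivWithinAt_pos (convex_Icc e c) (f' := p)
      (fun t ht => ((hq t (hsub2 ht)).continuousWithinAt.mono hsub2))
    · intro t ht
      exact (hq t (hsub2 (interior_subset ht))).mono (interior_subset.trans hsub2)
    · intro t ht
      rw [interior_Icc] at ht
      exact hp' t ⟨(le_max_left _ _).trans_lt ht.1, ht.2⟩
  have h4 := hmono (left_mem_Icc.2 hec.le) (right_mem_Icc.2 hec.le) hec
  linarith [hpos e ⟨hea, hec⟩]

/-- Starting points of solutions that leave through `q = 0`. -/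
def SA (u : ℝ → ℝ → ℝ → ℝ) (a : ℝ) : Set (ℝ × ℝ) :=
  {x | ∃ T f, a ≤ T ∧ Sol u a x T f ∧ (∀ t ∈ Icc a T, (f t).1 < π) ∧ (f T).1 < 0}

/-- Starting points of solutions that leave through `q = π`. -/
def SB (u : ℝ → ℝ → ℝ → ℝ) (a : ℝ) : Set (ℝ × ℝ) :=
  {x | ∃ T f, a ≤ T ∧ Sol u a x T f ∧ (∀ t ∈ Icc a T, 0 < (f t).1) ∧ π < (f T).1}

lemma fst_abs (x y : ℝ × ℝ) : |x.1 - y.1| ≤ dist x y := by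
  rw [Prod.dist_eq]; exact le_max_left _ _

lemma SA_open {u : ℝ → ℝ → ℝ → ℝ}
    (hu : Continuous fun x : ℝ × ℝ × ℝ => u x.1 x.2.1 x.2.2) (hl : Lip u) (a : ℝ) :
    IsOpen (SA u a) := by
  rw [Metric.isOpen_iff]
  rintro x ⟨T, f, hT, hf, hlt, hneg⟩
  obtain ⟨s, hs, hmax⟩ := isCompact_Icc.exists_isMaxOn (nonempty_Icc.2 hT)
    (continuous_fst.comp_continuousOn hf.cont)
  have hε : 0 < min (π - (f s).1) (-(f T).1) :=
    lt_min (by linarith [hlt s hs]) (by linarith)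
  obtain ⟨δ, hδ, h⟩ := hf.nearby hu hl hT hε
  refine ⟨δ, hδ, fun y hy => ?_⟩
  obtain ⟨g, hg, hd⟩ := h y hy
  refine ⟨T, g, hT, hg, fun t ht => ?_, ?_⟩
  · have h1 := (abs_le.1 (fst_abs (g t) (f t))).2
    have h2 := (hd t ht).trans_le (min_le_left _ _)
    have h3 : (f t).1 ≤ (f s).1 := hmax ht
    linarith
  · have h1 := (abs_le.1 (fst_abs (g T) (f T))).2
    have h2 := (hd T (right_mem_Icc.2 hT)).trans_le (min_le_right _ _)
    linarith

lemma SB_open {u : ℝ → ℝ → ℝ → ℝ}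
    (hu : Continuous fun x : ℝ × ℝ × ℝ => u x.1 x.2.1 x.2.2) (hl : Lip u) (a : ℝ) :
    IsOpen (SB u a) := by
  rw [Metric.isOpen_iff]
  rintro x ⟨T, f, hT, hf, hlt, hneg⟩
  obtain ⟨s, hs, hmax⟩ := isCompact_Icc.exists_isMinOn (nonempty_Icc.2 hT)
    (continuous_fst.comp_continuousOn hf.cont)
  have hε : 0 < min (f s).1 ((f T).1 - π) :=
    lt_min (by linarith [hlt s hs]) (by linarith)
  obtain ⟨δ, hδ, h⟩ := hf.nearby hu hl hT hε
  refine ⟨δ, hδ, fun y hy => ?_⟩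
  obtain ⟨g, hg, hd⟩ := h y hy
  refine ⟨T, g, hT, hg, fun t ht => ?_, ?_⟩
  · have h1 := (abs_le.1 (fst_abs (g t) (f t))).1
    have h2 := (hd t ht).trans_le (min_le_left _ _)
    have h3 : (f s).1 ≤ (f t).1 := hmax ht
    linarith
  · have h1 := (abs_le.1 (fst_abs (g T) (f T))).1
    have h2 := (hd T (right_mem_Icc.2 hT)).trans_le (min_le_right _ _)
    linarith

lemma SAB_disj {u : ℝ → ℝ → ℝ → ℝ}
    (hu : Continuous fun x : ℝ × ℝ × ℝ => u x.1 x.2.1 x.2.2) (hl : Lip u) (a : ℝ)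
    (x : ℝ × ℝ) (hA : x ∈ SA u a) (hB : x ∈ SB u a) : False := by
  obtain ⟨T, f, hT, hf, hf1, hf2⟩ := hA
  obtain ⟨S, g, hS, hg, hg1, hg2⟩ := hB
  rcases le_total T S with h | h
  · have e := hf.unique hu hl (hg.mono h) (right_mem_Icc.2 hT)
    have := hg1 T ⟨hT, h⟩
    rw [← e] at this
    linarith
  · have e := (hf.mono h).unique hu hl hg (right_mem_Icc.2 hS)
    have := hf1 S ⟨hS, h⟩
    rw [e] at this
    linarith

/-- Exit through `q = 0` at time `c`. -/
lemma exit_A {u : ℝ → ℝ → ℝ → ℝ} {a T c : ℝ} {x : ℝ × ℝ} {f : ℝ → ℝ × ℝ}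
    (hf : Sol u a x T f) (hac : a ≤ c) (hc : c < T) (h : ∀ t ∈ Ico a c, (f t).1 < π)
    (h0 : (f c).1 = 0) (hp : (f c).2 < 0) : x ∈ SA u a := by
  obtain ⟨S, hcS, hST, hS⟩ := after_cross hac hc (hf.fst ⟨hac, hc.le⟩) hp h0
  refine ⟨S, f, hac.trans hcS.le, hf.mono hST, fun t ht => ?_, hS S ⟨hcS, le_rfl⟩⟩
  rcases lt_trichotomy t c with h1 | h1 | h1
  · exact h t ⟨ht.1, h1⟩
  · rw [h1, h0]; exact pi_pos
  · exact (hS t ⟨h1, ht.2⟩).trans pi_pos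

/-- Exit through `q = π` at time `c`. -/
lemma exit_B {u : ℝ → ℝ → ℝ → ℝ} {a T c : ℝ} {x : ℝ × ℝ} {f : ℝ → ℝ × ℝ}
    (hf : Sol u a x T f) (hac : a ≤ c) (hc : c < T) (h : ∀ t ∈ Ico a c, 0 < (f t).1)
    (h0 : (f c).1 = π) (hp : 0 < (f c).2) : x ∈ SB u a := by
  obtain ⟨S, hcS, hST, hS⟩ := after_cross hac hc ((hf.fst ⟨hac, hc.le⟩).const_sub π)
    (by linarith) (by simp [h0])
  refine ⟨S, f, hac.trans hcS.le, hf.mono hST, fun t ht => ?_,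
    by linarith [hS S ⟨hcS, le_rfl⟩]⟩
  rcases lt_trichotomy t c with h1 | h1 | h1
  · exact h t ⟨ht.1, h1⟩
  · rw [h1, h0]; exact pi_pos
  · linarith [hS t ⟨h1, ht.2⟩, pi_pos]

lemma stays {u : ℝ → ℝ → ℝ → ℝ} {a T : ℝ} {x : ℝ × ℝ} {f : ℝ → ℝ × ℝ} (hT : a ≤ T)
    (hf : Sol u a x T f) (hx : x.1 ∈ Ioo 0 π) (hA : x ∉ SA u a) (hB : x ∉ SB u a) :
    (f T).1 ∈ Icc 0 π := by
  by_contra hout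
  have hcont : ContinuousOn (fun t => (f t).1) (Icc a T) :=
    continuous_fst.comp_continuousOn hf.cont
  have hclosed : IsClosed (Icc a T ∩ (fun t => (f t).1) ⁻¹' (Ioo 0 π)ᶜ) :=
    hcont.preimage_isClosed_of_isClosed isClosed_Icc isOpen_Ioo.isClosed_compl
  have hcomp : IsCompact (Icc a T ∩ (fun t => (f t).1) ⁻¹' (Ioo 0 π)ᶜ) :=
    isCompact_Icc.of_isClosed_subset hclosed inter_subset_left
  obtain ⟨c, ⟨hcI, hcn⟩, hmin⟩ := hcomp.exists_isLeast
    ⟨T, right_mem_Icc.2 hT, fun h => hout (Ioo_subset_Icc_self h)⟩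
  have hbefore : ∀ t ∈ Ico a c, (f t).1 ∈ Ioo 0 π := by
    intro t ht
    by_contra hn
    have := hmin ⟨⟨ht.1, ht.2.le.trans hcI.2⟩, hn⟩
    linarith [ht.2]
  have hac : a < c := by
    rcases hcI.1.lt_or_eq with h | h
    · exact h
    · subst h
      exact absurd (by simpa [hf.1] using hx) hcn
  have hcc : (f c).1 ∈ Icc 0 π := by
    rw [← closure_Ioo pi_pos.ne]
    have hm : MapsTo (fun t => (f t).1) (Ico a c) (Ioo 0 π) := hbefore
    refine hm.closure_of_continuousOn ?_ ?_
    · rw [closure_Ico hac.ne]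
      exact hcont.mono (Icc_subset_Icc_right hcI.2)
    · rw [closure_Ico hac.ne]
      exact right_mem_Icc.2 hac.le
  have hcT : c < T := by
    rcases hcI.2.lt_or_eq with h | h
    · exact h
    · subst h
      exact absurd hcc hout
  have hcase : (f c).1 = 0 ∨ (f c).1 = π := by
    by_contra hn
    push Not at hn
    exact hcn ⟨lt_of_le_of_ne hcc.1 hn.1.symm, lt_of_le_of_ne hcc.2 hn.2⟩
  rcases hcase with h0 | h0
  · refine hA (exit_A hf hac.le hcT (fun t ht => (hbefore t ht).2) h0 ?_)
    refine speed_neg (q := fun t => (f t).1) (p := fun t => (f t).2) hac hcI.2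
      (fun t ht => hf.fst ht) ?_ (fun t ht => (hbefore t ht).1) h0
    have := hf.snd hcI
    simpa [h0] using this
  · refine hB (exit_B hf hac.le hcT (fun t ht => (hbefore t ht).1) h0 ?_)
    have := speed_neg (q := fun t => π - (f t).1) (p := fun t => -(f t).2) hac hcI.2
      (fun t ht => (hf.fst ht).const_sub π) ?_
      (fun t ht => by linarith [(hbefore t ht).2]) (by simp [h0])
    · simpa using this
    · have := (hf.snd hcI).neg
      simp only [h0, sin_pi, cos_pi, mul_zero, zero_sub, neg_neg] at this
      exact this

lemma exists_start {u : ℝ → ℝ → ℝ → ℝ}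
    (hu : Continuous fun x : ℝ × ℝ × ℝ => u x.1 x.2.1 x.2.2) (hl : Lip u) (a : ℝ) :
    ∃ x : ℝ × ℝ, x.1 ∈ Ioo 0 π ∧ x ∉ SA u a ∧ x ∉ SB u a := by
  have hA0 : ((0, -1) : ℝ × ℝ) ∈ SA u a := by
    obtain ⟨T, hT, f, hf⟩ := local_exists hu hl a (0, -1)
    exact exit_A hf le_rfl hT (fun t ht => absurd ht (by simp)) (by simp [hf.1]) (by simp [hf.1])
  have hB1 : ((π, 1) : ℝ × ℝ) ∈ SB u a := by
    obtain ⟨T, hT, f, hf⟩ := local_exists hu hl a (π, 1)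
    exact exit_B hf le_rfl hT (fun t ht => absurd ht (by simp)) (by simp [hf.1]) (by simp [hf.1])
  set γ : ℝ → ℝ × ℝ := fun s => (π * s, 2 * s - 1) with hγ
  have hγc : Continuous γ := by fun_prop
  have e0 : γ 0 = (0, -1) := by simp [hγ]
  have e1 : γ 1 = (π, 1) := by simp [hγ]; norm_num
  by_contra hno
  push Not at hno
  have hcover : Icc (0 : ℝ) 1 ⊆ γ ⁻¹' SA u a ∪ γ ⁻¹' SB u a := by
    intro s hs
    rcases hs.1.lt_or_eq with h | h
    · rcases hs.2.lt_or_eq with h' | h'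
      · by_cases hh : γ s ∈ SA u a
        · exact Or.inl hh
        · refine Or.inr (hno (γ s) ⟨?_, ?_⟩ hh)
          · change 0 < π * s
            exact mul_pos pi_pos h
          · change π * s < π
            nlinarith [pi_pos]
      · right
        rw [mem_preimage, h', e1]; exact hB1
    · left
      rw [mem_preimage, ← h, e0]; exact hA0
  obtain ⟨s, -, hsA, hsB⟩ := isPreconnected_Icc (a := (0 : ℝ)) (b := 1) _ _
    ((SA_open hu hl a).preimage hγc) ((SB_open hu hl a).preimage hγc) hcover
    ⟨0, by simp, by rw [mem_preimage, e0]; exact hA0⟩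
    ⟨1, by simp, by rw [mem_preimage, e1]; exact hB1⟩
  exact SAB_disj hu hl a _ hsA hsB

end PendAux

/-- No Lipschitz control can globally stabilize the pendulum at a position `q*` below the
horizon (`q* < 0` or `q* > π`): for any `t₀` there is an initial condition `(q₀,p₀)` with
`0 < q₀ < π` such that every solution of `q̇ = p, ṗ = u(q,p,t)·sin q − cos q` starting
there satisfies `|q(t) − q*| ≥ dist(q*, [0,π]) > 0` for all `t ≥ t₀` in its interval of
existence. -/
theorem inverted_pendulum_no_stabilization_below_horizon
    (u : ℝ → ℝ → ℝ → ℝ)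
    (hu_cont : Continuous fun x : ℝ × ℝ × ℝ => u x.1 x.2.1 x.2.2)
    (hu_lip : ∀ K : Set (ℝ × ℝ × ℝ), IsCompact K → ∃ L : ℝ,
      ∀ a ∈ K, ∀ b ∈ K, a.2.2 = b.2.2 →
        |u a.1 a.2.1 a.2.2 - u b.1 b.2.1 b.2.2| ≤
          L * dist ((a.1, a.2.1) : ℝ × ℝ) ((b.1, b.2.1) : ℝ × ℝ))
    (qstar : ℝ) (hqstar : qstar < 0 ∨ π < qstar)
    (t₀ : ℝ) :
    0 < Metric.infDist qstar (Icc 0 π) ∧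
    ∃ q₀ p₀ : ℝ, 0 < q₀ ∧ q₀ < π ∧
      ∀ I : Set ℝ, t₀ ∈ I → I.OrdConnected →
        ∀ q p : ℝ → ℝ,
          (∀ t ∈ I, HasDerivWithinAt q (p t) I t) →
          (∀ t ∈ I, HasDerivWithinAt p
            (u (q t) (p t) t * sin (q t) - cos (q t)) I t) →
          q t₀ = q₀ → p t₀ = p₀ →
          ∀ t ∈ I, t₀ ≤ t →
            Metric.infDist qstar (Icc 0 π) ≤ |q t - qstar| := by
  have hpi := pi_pos
  have hdisj : qstar ∉ Icc 0 π := by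
    rintro ⟨h1, h2⟩
    rcases hqstar with h | h <;> linarith
  refine ⟨(isClosed_Icc.notMem_iff_infDist_pos (nonempty_Icc.2 hpi.le)).1 hdisj, ?_⟩
  obtain ⟨x, hx, hA, hB⟩ := PendAux.exists_start hu_cont hu_lip t₀
  refine ⟨x.1, x.2, hx.1, hx.2, ?_⟩
  intro I h0 hI q p hq hp hq0 hp0 t ht htt
  have hsub : Icc t₀ t ⊆ I := hI.out h0 ht
  have hsol : PendAux.Sol u t₀ x t (fun s => (q s, p s)) := by
    refine ⟨by simp [hq0, hp0], fun s hs => ?_⟩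
    exact ((hq s (hsub hs)).mono hsub).prodMk ((hp s (hsub hs)).mono hsub)
  have hmem : q t ∈ Icc 0 π := PendAux.stays htt hsol hx hA hB
  have := Metric.infDist_le_dist_of_mem (x := qstar) hmem
  rwa [dist_comm, Real.dist_eq] at this
end
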